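/- arXiv:1904.05830 — 6 statements merged into one kernel-verified Lean document; each statement's English description precedes it below -/
import Mathlib

section
/- Let $a_1 < b_1 < a_2 < b_2$ be real numbers and let $f_1 : [a_1,b_1] \to \mathbb{R}$, $f_2 : [a_2,b_2] \to \mathbb{R}$ be smooth functions such that for $i = 1,2$: (a) $f_i > 0$, $f_i' > 0$ and $f_i'' > 0$ on $[a_i,b_i]$; (b) $1 - f_i'(s)^2 - 2 f_i(s) f_i''(s) > 0$ for all $s \in [a_i,b_i]$; (c) $f_1(b_1) < f_2(a_2)$ and $f_1'(b_1) = f_2'(a_2)$; and (d) $(a_2 - b_1) f_1'(b_1) = f_2(a_2) - f_1(b_1)$. Then there exists a smooth function $f : [a_1,b_2] \to \mathbb{R}$ such that: (A) $f > 0$ and $f' > 0$ on $[a_1,b_2]$; (B) $f \equiv f_1$ on $[a_1, (a_1+b_1)/2]$ and $f \equiv f_2$ on $[(a_2+b_2)/2, b_2]$; and (C) $1 - f'(s)^2 - 2 f(s) f''(s) > 0$ for all $s \in [a_1,b_2]$. -/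
open Set

open Filter Topology
open scoped ContDiff

/-- Positivity of a profile, of its slope and of its scalar curvature, as a condition on the
2-jet `(x, y, z)`. -/
def AdmissibleJet (x y z : ℝ) : Prop :=
  0 < x ∧ 0 < y ∧ 0 < 1 - y ^ 2 - 2 * x * z

theorem AdmissibleJet.mono {x y z z' : ℝ} (h : AdmissibleJet x y z') (hz : z ≤ z') :
    AdmissibleJet x y z := by
  obtain ⟨hx, hy, h⟩ := h
  exact ⟨hx, hy, by nlinarith [mul_le_mul_of_nonneg_left hz hx.le]⟩

/-- A compact curve of admissible jets has a uniform neighbourhood of admissible jets; only an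
upper bound on the second derivative is needed. -/
theorem exists_uniform_admissibleJet {a b : ℝ} {u v w : ℝ → ℝ}
    (hu : ContinuousOn u (Icc a b)) (hv : ContinuousOn v (Icc a b))
    (hw : ContinuousOn w (Icc a b)) (h : ∀ s ∈ Icc a b, AdmissibleJet (u s) (v s) (w s)) :
    ∃ ε > 0, ∀ s ∈ Icc a b, ∀ x y z : ℝ, |x - u s| < ε → |y - v s| < ε → z < w s + ε →
      AdmissibleJet x y z := by
  have hopen : IsOpen {p : ℝ × ℝ × ℝ | AdmissibleJet p.1 p.2.1 p.2.2} := by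
    have e : {p : ℝ × ℝ × ℝ | AdmissibleJet p.1 p.2.1 p.2.2} =
        {p | 0 < p.1} ∩ ({p | 0 < p.2.1} ∩ {p | 0 < 1 - p.2.1 ^ 2 - 2 * p.1 * p.2.2}) := rfl
    rw [e]
    refine (isOpen_lt ?_ ?_).inter ((isOpen_lt ?_ ?_).inter (isOpen_lt ?_ ?_)) <;> fun_prop
  have hK : IsCompact ((fun s => (u s, v s, w s)) '' Icc a b) :=
    isCompact_Icc.image_of_continuousOn (hu.prodMk (hv.prodMk hw))
  obtain ⟨ε, hε, hsub⟩ := hK.exists_thickening_subset_open hopen (by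
    rintro _ ⟨s, hs, rfl⟩
    exact h s hs)
  refine ⟨ε, hε, fun s hs x y z hx hy hz => ?_⟩
  have hmem : (x, y, max z (w s)) ∈
      Metric.thickening ε ((fun s => (u s, v s, w s)) '' Icc a b) := by
    rw [Metric.mem_thickening_iff]
    refine ⟨_, ⟨s, hs, rfl⟩, ?_⟩
    simp only [Prod.dist_eq, Real.dist_eq, max_lt_iff]
    refine ⟨hx, hy, ?_⟩
    rw [abs_of_nonneg (by linarith [le_max_right z (w s)]), sub_lt_iff_lt_add, max_lt_iff]
    constructor <;> linarith
  have hadm : AdmissibleJet x y (max z (w s)) := hsub hmem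
  exact hadm.mono (le_max_left _ _)

theorem hasDerivAt_add_integral {k : ℝ → ℝ} (hk : Continuous k) (r c s : ℝ) :
    HasDerivAt (fun s => r + ∫ t in c..s, k t) (k s) s :=
  (intervalIntegral.integral_hasDerivAt_right (hk.intervalIntegrable _ _)
    (hk.stronglyMeasurableAtFilter _ _) hk.continuousAt).const_add r

theorem contDiff_add_integral {k : ℝ → ℝ} (hk : ContDiff ℝ ∞ k) (r c : ℝ) :
    ContDiff ℝ ∞ (fun s => r + ∫ t in c..s, k t) := by
  have h := hasDerivAt_add_integral hk.continuous r c
  rw [contDiff_infty_iff_deriv]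
  refine ⟨fun s => (h s).differentiableAt, ?_⟩
  rwa [show deriv (fun s => r + ∫ t in c..s, k t) = k from funext fun s => (h s).deriv]

/-- The product of a bump function supported in an interval and a function smooth in the interior
of that interval is smooth. -/
theorem contDiff_bump_mul {c ρ : ℝ} (χ : ContDiffBump c) (hρ : χ.rOut < ρ) {w : ℝ → ℝ}
    (hw : ∀ s, |s - c| < ρ → ContDiffAt ℝ ∞ w s) : ContDiff ℝ ∞ (fun s => χ s * w s) := by
  rw [contDiff_iff_contDiffAt]
  intro s
  by_cases hs : |s - c| < ρ
  · exact χ.contDiff.contDiffAt.mul (hw s hs)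
  · have hfar : ∀ᶠ t in 𝓝 s, χ.rOut < |t - c| :=
      (by fun_prop : Continuous fun t : ℝ => |t - c|).continuousAt.eventually
        (lt_mem_nhds (hρ.trans_le (not_lt.mp hs)))
    refine contDiffAt_const (c := (0 : ℝ)) |>.congr_of_eventuallyEq ?_
    filter_upwards [hfar] with t ht
    rw [χ.zero_of_le_dist (by rw [Real.dist_eq]; exact ht.le), zero_mul]

/-- A smooth convex function on `[a, b]` is `C¹`-approximated on `[a, b]` by smooth functions which
coincide with it near the midpoint, have smaller second derivative, and are affine outside. -/
theorem exists_contDiff_affine_outside {a b ε : ℝ} (hab : a < b) (hε : 0 < ε) {u : ℝ → ℝ}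
    (hu : ContDiffOn ℝ ∞ u (Icc a b))
    (hconv : ∀ s ∈ Icc a b, 0 ≤ derivWithin (derivWithin u (Icc a b)) (Icc a b) s) :
    ∃ F F' F'' : ℝ → ℝ, ContDiff ℝ ∞ F ∧ (∀ s, HasDerivAt F (F' s) s) ∧
      (∀ s, HasDerivAt F' (F'' s) s) ∧
      (∃ η > 0, ∀ s, |s - (a + b) / 2| < η → F s = u s) ∧
      (∀ s ∈ Icc a b, |F s - u s| ≤ ε ∧ |F' s - derivWithin u (Icc a b) s| ≤ ε ∧
        F'' s ≤ derivWithin (derivWithin u (Icc a b)) (Icc a b) s) ∧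
      ∀ s ∉ Ioo a b, F'' s = 0 := by
  have hI : UniqueDiffOn ℝ (Icc a b) := uniqueDiffOn_Icc hab
  set v := derivWithin u (Icc a b) with hv_def
  set w := derivWithin v (Icc a b) with hw_def
  have hv : ContDiffOn ℝ ∞ v (Icc a b) := hu.derivWithin hI (by simp)
  have hw : ContDiffOn ℝ ∞ w (Icc a b) := hv.derivWithin hI (by simp)
  have hdu : ∀ s ∈ Icc a b, HasDerivWithinAt u (v s) (Icc a b) s := fun s hs =>
    (hu.differentiableOn (by simp) s hs).hasDerivWithinAt
  have hdv : ∀ s ∈ Icc a b, HasDerivWithinAt v (w s) (Icc a b) s := fun s hs =>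
    (hv.differentiableOn (by simp) s hs).hasDerivWithinAt
  obtain ⟨W, hW⟩ := isCompact_Icc.exists_bound_of_continuousOn hw.continuousOn
  have hW0 : 0 ≤ W := (norm_nonneg _).trans (hW a (left_mem_Icc.2 hab.le))
  set c := (a + b) / 2 with hc
  obtain ⟨δ, hδ, hδ4, hδε, hδε'⟩ : ∃ δ > 0, δ ≤ (b - a) / 4 ∧ W * δ ≤ ε ∧
      W * δ * (b - a) ≤ ε := by
    have hl : 0 < b - a := by linarith
    have hQ : 0 < (W + 1) * (1 + (b - a)) := by positivity
    refine ⟨min ((b - a) / 4) (ε / ((W + 1) * (1 + (b - a)))), by positivity, min_le_left _ _, ?_⟩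
    set δ := min ((b - a) / 4) (ε / ((W + 1) * (1 + (b - a))))
    have h0 : 0 < δ := by positivity
    have h1 : δ * ((W + 1) * (1 + (b - a))) ≤ ε := (le_div_iff₀ hQ).1 (min_le_right _ _)
    have h2 : 0 ≤ δ * W := by positivity
    have h3 : 0 ≤ δ * W * (b - a) := by positivity
    have h4 : 0 ≤ δ * (b - a) := by positivity
    constructor <;> nlinarith
  let χ : ContDiffBump c := ⟨(b - a) / 2 - δ, (b - a) / 2 - δ / 2, by linarith, by linarith⟩
  have hχ1 : ∀ s ∈ Icc (a + δ) (b - δ), χ s = 1 := fun s hs =>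
    χ.one_of_mem_closedBall (by
      rw [Metric.mem_closedBall, Real.dist_eq, abs_le]
      constructor <;> simp only [χ, hc] <;> linarith [hs.1, hs.2])
  set k := fun s => χ s * w s with hk_def
  have hk : ContDiff ℝ ∞ k := by
    refine contDiff_bump_mul χ (ρ := (b - a) / 2) (by simp only [χ]; linarith) fun s hs => ?_
    rw [abs_lt] at hs
    exact hw.contDiffAt (Icc_mem_nhds (by linarith [hs.1]) (by linarith [hs.2]))
  set G := fun s => v c + ∫ t in c..s, k t with hG_def
  set F := fun s => u c + ∫ t in c..s, G t with hF_def
  have hG : ContDiff ℝ ∞ G := contDiff_add_integral hk _ _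
  have hdG : ∀ s, HasDerivAt G (k s) s := hasDerivAt_add_integral hk.continuous _ _
  have hdF : ∀ s, HasDerivAt F (G s) s := hasDerivAt_add_integral hG.continuous _ _
  have hsub : Icc (a + δ) (b - δ) ⊆ Icc a b := Icc_subset_Icc (by linarith) (by linarith)
  have hcmid : c ∈ Icc (a + δ) (b - δ) := ⟨by linarith, by linarith⟩
  have hD : ∀ s ∈ Icc a b, HasDerivWithinAt (fun s => G s - v s) (k s - w s) (Icc a b) s :=
    fun s hs => (hdG s).hasDerivWithinAt.sub (hdv s hs)
  have hE : ∀ s ∈ Icc a b, HasDerivWithinAt (fun s => F s - u s) (G s - v s) (Icc a b) s :=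
    fun s hs => (hdF s).hasDerivWithinAt.sub (hdu s hs)
  have hkw : ∀ s ∈ Icc a b, ‖k s - w s‖ ≤ W := by
    intro s hs
    have h1 := hW s hs
    have h2 := hconv s hs
    have h3 := mul_nonneg (χ.nonneg (x := s)) h2
    have h4 := mul_le_mul_of_nonneg_right (χ.le_one (x := s)) h2
    simp only [hk_def, Real.norm_eq_abs] at h1 ⊢
    rw [abs_le] at h1 ⊢
    constructor <;> linarith
  have hDc : G c - v c = 0 := by simp [hG_def]
  have hEc : F c - u c = 0 := by simp [hF_def]
  have hDmid : ∀ s ∈ Icc (a + δ) (b - δ), G s - v s = 0 := by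
    intro s hs
    have h := (convex_Icc (a + δ) (b - δ)).norm_image_sub_le_of_norm_hasDerivWithin_le (C := 0)
      (fun x hx => (hD x (hsub hx)).mono hsub) (fun x hx => by simp [hk_def, hχ1 x hx]) hcmid hs
    simpa [hDc] using h
  have hEmid : ∀ s ∈ Icc (a + δ) (b - δ), F s - u s = 0 := by
    intro s hs
    have h := (convex_Icc (a + δ) (b - δ)).norm_image_sub_le_of_norm_hasDerivWithin_le (C := 0)
      (fun x hx => (hE x (hsub hx)).mono hsub) (fun x hx => by simp [hDmid x hx]) hcmid hs
    simpa [hEc] using h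
  have hDbound : ∀ s ∈ Icc a b, |G s - v s| ≤ W * δ := by
    intro s hs
    obtain ⟨x, hx, hxs⟩ : ∃ x ∈ Icc (a + δ) (b - δ), ‖s - x‖ ≤ δ := by
      simp only [Real.norm_eq_abs, abs_le]
      rcases le_total s c with h | h
      · exact ⟨max s (a + δ), ⟨le_max_right _ _, max_le (by linarith) (by linarith)⟩,
          by linarith [show max s (a + δ) ≤ s + δ from max_le (by linarith) (by linarith [hs.1])],
          by linarith [le_max_left s (a + δ)]⟩
      · exact ⟨min s (b - δ), ⟨le_min (by linarith) (by linarith), min_le_right _ _⟩,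
          by linarith [min_le_left s (b - δ)],
          by linarith [show s - δ ≤ min s (b - δ) from le_min (by linarith) (by linarith [hs.2])]⟩
    have h := (convex_Icc a b).norm_image_sub_le_of_norm_hasDerivWithin_le hD hkw (hsub hx) hs
    rw [hDmid x hx, sub_zero] at h
    exact h.trans (mul_le_mul_of_nonneg_left hxs hW0)
  refine ⟨F, G, k, contDiff_add_integral hG _ _, hdF, hdG, ⟨(b - a) / 4, by linarith, ?_⟩, ?_, ?_⟩
  · intro s hs
    rw [abs_lt] at hs
    exact sub_eq_zero.1 (hEmid s ⟨by linarith [hs.1], by linarith [hs.2]⟩)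
  · intro s hs
    refine ⟨?_, (hDbound s hs).trans hδε, mul_le_of_le_one_left (hconv s hs) χ.le_one⟩
    have h := (convex_Icc a b).norm_image_sub_le_of_norm_hasDerivWithin_le hE hDbound
      (hsub hcmid) hs
    rw [hEc, sub_zero] at h
    refine h.trans (le_trans (mul_le_mul_of_nonneg_left ?_ (by positivity)) hδε')
    rw [Real.norm_eq_abs, abs_le]
    constructor <;> linarith [hs.1, hs.2]
  · intro s hs
    have h : χ s = 0 := χ.zero_of_le_dist (by
      rw [Real.dist_eq, le_abs]
      simp only [χ]
      by_contra! hlt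
      exact hs ⟨by linarith [hlt.2], by linarith [hlt.1]⟩)
    simp [hk_def, h]

/-- A function with vanishing second derivative on `[p, q]` that is `C¹`-close to a line at one
point of `[p, q]` is `C¹`-close to that line on all of `[p, q]`. -/
theorem abs_sub_line_le {p q ε x₀ y₀ m : ℝ} {F F' F'' : ℝ → ℝ}
    (hF : ∀ s, HasDerivAt F (F' s) s) (hF' : ∀ s, HasDerivAt F' (F'' s) s)
    (hzero : ∀ s ∈ Icc p q, F'' s = 0) (hx₀ : x₀ ∈ Icc p q)
    (h0 : |F x₀ - y₀| ≤ ε) (h1 : |F' x₀ - m| ≤ ε) :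
    ∀ s ∈ Icc p q, |F s - (y₀ + m * (s - x₀))| ≤ ε * (1 + (q - p)) ∧ |F' s - m| ≤ ε := by
  have hslope : ∀ s ∈ Icc p q, |F' s - m| ≤ ε := by
    intro s hs
    have h := (convex_Icc p q).norm_image_sub_le_of_norm_hasDerivWithin_le (C := 0)
      (fun x _ => (hF' x).hasDerivWithinAt) (fun x hx => by simp [hzero x hx]) hx₀ hs
    have h' : F' s = F' x₀ := by simpa [sub_eq_zero] using h
    rwa [h']
  intro s hs
  refine ⟨?_, hslope s hs⟩
  have hd : ∀ x ∈ Icc p q, HasDerivWithinAt (fun x => F x - (y₀ + m * (x - x₀))) (F' x - m)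
      (Icc p q) x := fun x _ => by
    have h : HasDerivAt (fun x => y₀ + m * (x - x₀)) m x := by
      simpa using (((hasDerivAt_id x).sub_const x₀).const_mul m).const_add y₀
    exact ((hF x).sub h).hasDerivWithinAt
  have h := (convex_Icc p q).norm_image_sub_le_of_norm_hasDerivWithin_le hd hslope hx₀ hs
  have hε : 0 ≤ ε := (abs_nonneg _).trans h0
  have hdist : ‖s - x₀‖ ≤ q - p := by
    rw [Real.norm_eq_abs, abs_le]
    constructor <;> linarith [hs.1, hs.2, hx₀.1, hx₀.2]
  have h2 := h.trans (mul_le_mul_of_nonneg_left hdist hε)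
  simp only [sub_self, mul_zero, add_zero, Real.norm_eq_abs] at h2
  rw [abs_le] at h2 h0 ⊢
  constructor <;> linarith [h2.1, h2.2, h0.1, h0.2]

/-- A smooth cutoff function from `0` to `1` across `[p, q]`. -/
theorem exists_contDiff_cutoff {p q : ℝ} (hpq : p < q) :
    ∃ θ : ℝ → ℝ, ContDiff ℝ ∞ θ ∧ (∀ s ≤ p, θ s = 0) ∧ (∀ s, q ≤ s → θ s = 1) ∧
      ∀ s, 0 ≤ θ s ∧ θ s ≤ 1 := by
  have hl : 0 < q - p := sub_pos.2 hpq
  refine ⟨fun s => Real.smoothTransition ((s - p) / (q - p)),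
    Real.smoothTransition.contDiff.comp (by fun_prop), fun s hs => ?_, fun s hs => ?_,
    fun s => ⟨Real.smoothTransition.nonneg _, Real.smoothTransition.le_one _⟩⟩
  · exact Real.smoothTransition.zero_of_nonpos (div_nonpos_of_nonpos_of_nonneg (by linarith) hl.le)
  · exact Real.smoothTransition.one_of_one_le ((one_le_div hl).2 (by linarith))

theorem eventuallyEq_derivWithin_of_eventuallyEq {f g : ℝ → ℝ} {I J : Set ℝ} {s : ℝ}
    (hfg : f =ᶠ[𝓝 s] g) (hIJ : J =ᶠ[𝓝 s] I) :
    derivWithin f J =ᶠ[𝓝 s] derivWithin g I := by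
  filter_upwards [hfg.eventuallyEq_nhds, hIJ.eventuallyEq_nhds] with t ht hJt
  rw [derivWithin_congr_set hJt]
  exact (ht.filter_mono nhdsWithin_le_nhds).derivWithin_eq ht.self_of_nhds

/-- Smoothness and admissibility of a function at a point only depend on its germ. -/
theorem contDiffWithinAt_and_admissibleJet_congr {f g : ℝ → ℝ} {I J : Set ℝ} {s : ℝ}
    (hfg : f =ᶠ[𝓝 s] g) (hIJ : J =ᶠ[𝓝 s] I) (hg : ContDiffWithinAt ℝ ∞ g I s)
    (hadm : AdmissibleJet (g s) (derivWithin g I s) (derivWithin (derivWithin g I) I s)) :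
    ContDiffWithinAt ℝ ∞ f J s ∧
      AdmissibleJet (f s) (derivWithin f J s) (derivWithin (derivWithin f J) J s) := by
  have h1 := eventuallyEq_derivWithin_of_eventuallyEq hfg hIJ
  have h2 := eventuallyEq_derivWithin_of_eventuallyEq h1 hIJ
  refine ⟨?_, by rwa [hfg.self_of_nhds, h1.self_of_nhds, h2.self_of_nhds]⟩
  exact ((contDiffWithinAt_congr_set hIJ).2 hg).congr_of_eventuallyEq
    (hfg.filter_mono nhdsWithin_le_nhds) hfg.self_of_nhds

/-- Version of `contDiffWithinAt_and_admissibleJet_congr` at an interior point. -/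
theorem contDiffWithinAt_and_admissibleJet_of_hasDerivAt {f g g' g'' : ℝ → ℝ} {J : Set ℝ} {s : ℝ}
    (hfg : f =ᶠ[𝓝 s] g) (hJ : J ∈ 𝓝 s) (hg : ContDiff ℝ ∞ g) (hg' : ∀ t, HasDerivAt g (g' t) t)
    (hg'' : ∀ t, HasDerivAt g' (g'' t) t) (hadm : AdmissibleJet (g s) (g' s) (g'' s)) :
    ContDiffWithinAt ℝ ∞ f J s ∧
      AdmissibleJet (f s) (derivWithin f J s) (derivWithin (derivWithin f J) J s) := by
  refine contDiffWithinAt_and_admissibleJet_congr hfg (eventuallyEq_univ.2 hJ)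
    hg.contDiffAt.contDiffWithinAt ?_
  have h1 : deriv g = g' := funext fun t => (hg' t).deriv
  have h2 : deriv g' s = g'' s := (hg'' s).deriv
  rwa [derivWithin_univ, derivWithin_univ, h1, h2]

/-- The jet of an interpolation between two functions that are `C¹`-close to the same line is
close to the jet of the line. -/
theorem abs_interpolation_sub_le {t t' t'' T κ x x' y y' l m : ℝ} (ht0 : 0 ≤ t) (ht1 : t ≤ 1)
    (ht' : |t'| ≤ T) (ht'' : |t''| ≤ T) (hx : |x - l| ≤ κ) (hy : |y - l| ≤ κ)
    (hx' : |x' - m| ≤ κ) (hy' : |y' - m| ≤ κ) :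
    |x + t * (y - x) - l| ≤ κ * (1 + 6 * T) ∧
      |x' + (t' * (y - x) + t * (y' - x')) - m| ≤ κ * (1 + 6 * T) ∧
      t'' * (y - x) + 2 * t' * (y' - x') ≤ κ * (1 + 6 * T) := by
  have hT : 0 ≤ T := (abs_nonneg _).trans ht'
  have hκ : 0 ≤ κ := (abs_nonneg _).trans hx
  have hκT : 0 ≤ κ * T := mul_nonneg hκ hT
  have hprod : ∀ r d : ℝ, |r| ≤ T → |d| ≤ 2 * κ → |r * d| ≤ T * (2 * κ) := fun r d hr hd => by
    rw [abs_mul]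
    exact mul_le_mul hr hd (abs_nonneg _) hT
  have hmix : ∀ r r' n : ℝ, |r - n| ≤ κ → |r' - n| ≤ κ → |r + t * (r' - r) - n| ≤ κ := by
    intro r r' n hr hr'
    rw [abs_le] at hr hr' ⊢
    constructor <;> nlinarith
  have hd : |y - x| ≤ 2 * κ := by
    rw [abs_le] at hx hy ⊢
    constructor <;> linarith [hx.1, hx.2, hy.1, hy.2]
  have hd' : |y' - x'| ≤ 2 * κ := by
    rw [abs_le] at hx' hy' ⊢
    constructor <;> linarith [hx'.1, hx'.2, hy'.1, hy'.2]
  have h1 := hmix x y l hx hy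
  have h2 := abs_le.1 (hmix x' y' m hx' hy')
  have h3 := abs_le.1 (hprod t' _ ht' hd)
  have h4 := abs_le.1 (hprod t'' _ ht'' hd)
  have h5 := abs_le.1 (hprod t' _ ht' hd')
  refine ⟨by linarith, abs_le.2 ⟨?_, ?_⟩, ?_⟩ <;> linarith [h2.1, h2.2, h3.1, h3.2, h4.2, h5.2]

/-- Mantoulidis–Schoen Gluing Lemma (radial profile form): two smooth rotationally
symmetric profiles of positive scalar curvature (i.e. `1 - f'^2 - 2 f f'' > 0`) with
matching slopes and a cone compatibility condition can be glued by a smooth profile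
of positive scalar curvature agreeing with the originals near the ends. -/
theorem gluing_lemma_MS
    (a₁ b₁ a₂ b₂ : ℝ) (h₁ : a₁ < b₁) (h₂ : b₁ < a₂) (h₃ : a₂ < b₂)
    (f₁ f₂ : ℝ → ℝ)
    (hf₁ : ContDiffOn ℝ (⊤ : ℕ∞) f₁ (Icc a₁ b₁))
    (hf₂ : ContDiffOn ℝ (⊤ : ℕ∞) f₂ (Icc a₂ b₂))
    (hpos₁ : ∀ s ∈ Icc a₁ b₁, 0 < f₁ s ∧ 0 < derivWithin f₁ (Icc a₁ b₁) s ∧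
      0 < derivWithin (derivWithin f₁ (Icc a₁ b₁)) (Icc a₁ b₁) s)
    (hpos₂ : ∀ s ∈ Icc a₂ b₂, 0 < f₂ s ∧ 0 < derivWithin f₂ (Icc a₂ b₂) s ∧
      0 < derivWithin (derivWithin f₂ (Icc a₂ b₂)) (Icc a₂ b₂) s)
    (hscal₁ : ∀ s ∈ Icc a₁ b₁,
      0 < 1 - (derivWithin f₁ (Icc a₁ b₁) s) ^ 2
        - 2 * f₁ s * derivWithin (derivWithin f₁ (Icc a₁ b₁)) (Icc a₁ b₁) s)
    (hscal₂ : ∀ s ∈ Icc a₂ b₂,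
      0 < 1 - (derivWithin f₂ (Icc a₂ b₂) s) ^ 2
        - 2 * f₂ s * derivWithin (derivWithin f₂ (Icc a₂ b₂)) (Icc a₂ b₂) s)
    (hlt : f₁ b₁ < f₂ a₂)
    (hder : derivWithin f₁ (Icc a₁ b₁) b₁ = derivWithin f₂ (Icc a₂ b₂) a₂)
    (hcone : (a₂ - b₁) * derivWithin f₁ (Icc a₁ b₁) b₁ = f₂ a₂ - f₁ b₁) :
    ∃ f : ℝ → ℝ, ContDiffOn ℝ (⊤ : ℕ∞) f (Icc a₁ b₂) ∧
      (∀ s ∈ Icc a₁ b₂, 0 < f s ∧ 0 < derivWithin f (Icc a₁ b₂) s) ∧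
      (∀ s ∈ Icc a₁ ((a₁ + b₁) / 2), f s = f₁ s) ∧
      (∀ s ∈ Icc ((a₂ + b₂) / 2) b₂, f s = f₂ s) ∧
      (∀ s ∈ Icc a₁ b₂,
        0 < 1 - (derivWithin f (Icc a₁ b₂) s) ^ 2
          - 2 * f s * derivWithin (derivWithin f (Icc a₁ b₂)) (Icc a₁ b₂) s) := by
  have hI₁ := uniqueDiffOn_Icc h₁
  have hI₂ := uniqueDiffOn_Icc h₃
  have hv₁ : ContDiffOn ℝ ∞ (derivWithin f₁ (Icc a₁ b₁)) (Icc a₁ b₁) :=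
    hf₁.derivWithin hI₁ (by simp)
  have hv₂ : ContDiffOn ℝ ∞ (derivWithin f₂ (Icc a₂ b₂)) (Icc a₂ b₂) :=
    hf₂.derivWithin hI₂ (by simp)
  have hadm₁ : ∀ s ∈ Icc a₁ b₁, AdmissibleJet (f₁ s) (derivWithin f₁ (Icc a₁ b₁) s)
      (derivWithin (derivWithin f₁ (Icc a₁ b₁)) (Icc a₁ b₁) s) :=
    fun s hs => ⟨(hpos₁ s hs).1, (hpos₁ s hs).2.1, hscal₁ s hs⟩
  have hadm₂ : ∀ s ∈ Icc a₂ b₂, AdmissibleJet (f₂ s) (derivWithin f₂ (Icc a₂ b₂) s)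
      (derivWithin (derivWithin f₂ (Icc a₂ b₂)) (Icc a₂ b₂) s) :=
    fun s hs => ⟨(hpos₂ s hs).1, (hpos₂ s hs).2.1, hscal₂ s hs⟩
  have hb₁ : b₁ ∈ Icc a₁ b₁ := right_mem_Icc.2 h₁.le
  have ha₂ : a₂ ∈ Icc a₂ b₂ := left_mem_Icc.2 h₃.le
  set m := derivWithin f₁ (Icc a₁ b₁) b₁ with hm
  have hadm₀ : ∀ s ∈ Icc b₁ a₂, AdmissibleJet (f₁ b₁ + m * (s - b₁)) m 0 := by
    intro s hs
    obtain ⟨hx, hy, hz⟩ := hadm₁ b₁ hb₁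
    refine ⟨add_pos_of_pos_of_nonneg hx (mul_nonneg hy.le (sub_nonneg.2 hs.1)), hy, ?_⟩
    have h := mul_pos hx (hpos₁ b₁ hb₁).2.2
    linarith
  obtain ⟨ε₁, hε₁, hnear₁⟩ := exists_uniform_admissibleJet hf₁.continuousOn hv₁.continuousOn
    (hv₁.derivWithin (m := ∞) hI₁ (by simp)).continuousOn hadm₁
  obtain ⟨ε₂, hε₂, hnear₂⟩ := exists_uniform_admissibleJet hf₂.continuousOn hv₂.continuousOn
    (hv₂.derivWithin (m := ∞) hI₂ (by simp)).continuousOn hadm₂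
  obtain ⟨ε₀, hε₀, hnear₀⟩ := exists_uniform_admissibleJet (a := b₁) (b := a₂)
    (u := fun s => f₁ b₁ + m * (s - b₁)) (v := fun _ => m) (w := fun _ => 0)
    (by fun_prop) (by fun_prop) (by fun_prop) hadm₀
  obtain ⟨θ, hθ, hθ0, hθ1, hθ01⟩ := exists_contDiff_cutoff h₂
  have hθ' : ContDiff ℝ ∞ (deriv θ) := (contDiff_infty_iff_deriv.1 hθ).2
  have hθ'' : ContDiff ℝ ∞ (deriv (deriv θ)) := (contDiff_infty_iff_deriv.1 hθ').2
  have hdθ : ∀ s, HasDerivAt θ (deriv θ s) s := fun s =>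
    (hθ.differentiable (by simp) s).hasDerivAt
  have hdθ' : ∀ s, HasDerivAt (deriv θ) (deriv (deriv θ) s) s := fun s =>
    (hθ'.differentiable (by simp) s).hasDerivAt
  obtain ⟨T, hT', hT''⟩ : ∃ T, (∀ s ∈ Icc b₁ a₂, |deriv θ s| ≤ T) ∧
      ∀ s ∈ Icc b₁ a₂, |deriv (deriv θ) s| ≤ T := by
    obtain ⟨T, hT⟩ := isCompact_Icc.exists_bound_of_continuousOn (s := Icc b₁ a₂)
      hθ'.continuous.continuousOn
    obtain ⟨T', hT'⟩ := isCompact_Icc.exists_bound_of_continuousOn (s := Icc b₁ a₂)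
      hθ''.continuous.continuousOn
    exact ⟨max T T', fun s hs => (hT s hs).trans (le_max_left _ _),
      fun s hs => (hT' s hs).trans (le_max_right _ _)⟩
  have hT0 : 0 ≤ T := (abs_nonneg _).trans (hT' b₁ (left_mem_Icc.2 h₂.le))
  obtain ⟨ε, hε, hεε₁, hεε₂, hεε₀⟩ : ∃ ε > 0, ε < ε₁ ∧ ε < ε₂ ∧
      ε * (1 + (a₂ - b₁)) * (1 + 6 * T) < ε₀ := by
    have hlim : Tendsto (fun ε : ℝ => ε * (1 + (a₂ - b₁)) * (1 + 6 * T)) (𝓝[>] 0) (𝓝 0) := by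
      have h : Continuous fun ε : ℝ => ε * (1 + (a₂ - b₁)) * (1 + 6 * T) := by fun_prop
      simpa using (h.tendsto 0).mono_left nhdsWithin_le_nhds
    obtain ⟨ε, h, h', hε⟩ := ((hlim.eventually_lt_const hε₀).and
      ((Ioo_mem_nhdsGT (lt_min hε₁ hε₂)))).exists
    exact ⟨ε, h', hε.trans_le (min_le_left _ _), hε.trans_le (min_le_right _ _), h⟩
  obtain ⟨F₁, F₁', F₁'', hF₁, hdF₁, hdF₁', ⟨η₁, hη₁, hmid₁⟩, hclose₁, hzero₁⟩ :=
    exists_contDiff_affine_outside h₁ hε hf₁ fun s hs => (hpos₁ s hs).2.2.le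
  obtain ⟨F₂, F₂', F₂'', hF₂, hdF₂, hdF₂', ⟨η₂, hη₂, hmid₂⟩, hclose₂, hzero₂⟩ :=
    exists_contDiff_affine_outside h₃ hε hf₂ fun s hs => (hpos₂ s hs).2.2.le
  have hgap₁ : ∀ s ∈ Icc b₁ a₂, F₁'' s = 0 := fun s hs =>
    hzero₁ s fun h => (h.2.trans_le hs.1).false
  have hgap₂ : ∀ s ∈ Icc b₁ a₂, F₂'' s = 0 := fun s hs =>
    hzero₂ s fun h => (h.1.trans_le hs.2).false
  have hline₁ := abs_sub_line_le hdF₁ hdF₁' hgap₁ (left_mem_Icc.2 h₂.le)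
    (hclose₁ b₁ hb₁).1 (hclose₁ b₁ hb₁).2.1
  have hline₂ := abs_sub_line_le hdF₂ hdF₂' hgap₂ (right_mem_Icc.2 h₂.le)
    (hclose₂ a₂ ha₂).1 (hclose₂ a₂ ha₂).2.1
  rw [← hm] at hline₁
  rw [← hder] at hline₂
  set G : ℝ → ℝ := fun s => F₁ s + θ s * (F₂ s - F₁ s) with hG
  have hGsmooth : ContDiff ℝ ∞ G := hF₁.add (hθ.mul (hF₂.sub hF₁))
  have hdG : ∀ s, HasDerivAt G
      (F₁' s + (deriv θ s * (F₂ s - F₁ s) + θ s * (F₂' s - F₁' s))) s := fun s =>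
    (hdF₁ s).add ((hdθ s).mul ((hdF₂ s).sub (hdF₁ s)))
  have hdG' : ∀ s, HasDerivAt
      (fun s => F₁' s + (deriv θ s * (F₂ s - F₁ s) + θ s * (F₂' s - F₁' s)))
      (F₁'' s + ((deriv (deriv θ) s * (F₂ s - F₁ s) + deriv θ s * (F₂' s - F₁' s)) +
        (deriv θ s * (F₂' s - F₁' s) + θ s * (F₂'' s - F₁'' s)))) s := fun s =>
    (hdF₁' s).add (((hdθ' s).mul ((hdF₂ s).sub (hdF₁ s))).add
      ((hdθ s).mul ((hdF₂' s).sub (hdF₁' s))))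
  have hGadm : ∀ s ∈ Icc b₁ a₂, AdmissibleJet (G s)
      (F₁' s + (deriv θ s * (F₂ s - F₁ s) + θ s * (F₂' s - F₁' s)))
      (F₁'' s + ((deriv (deriv θ) s * (F₂ s - F₁ s) + deriv θ s * (F₂' s - F₁' s)) +
        (deriv θ s * (F₂' s - F₁' s) + θ s * (F₂'' s - F₁'' s)))) := by
    intro s hs
    have hκ : ε ≤ ε * (1 + (a₂ - b₁)) :=
      le_mul_of_one_le_right hε.le (by linarith)
    obtain ⟨hx, hx'⟩ := hline₁ s hs
    obtain ⟨hy, hy'⟩ := hline₂ s hs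
    rw [show f₂ a₂ + m * (s - a₂) = f₁ b₁ + m * (s - b₁) by linarith] at hy
    obtain ⟨hjet, hjet', hjet''⟩ := abs_interpolation_sub_le (hθ01 s).1 (hθ01 s).2 (hT' s hs)
      (hT'' s hs) hx hy (hx'.trans hκ) (hy'.trans hκ)
    refine hnear₀ s hs _ _ _ (hjet.trans_lt hεε₀) (hjet'.trans_lt hεε₀) ?_
    rw [hgap₁ s hs, hgap₂ s hs]
    linarith
  have hGleft : ∀ s ≤ b₁, G s = F₁ s := fun s hs => by simp [hG, hθ0 s hs]
  have hGright : ∀ s, a₂ ≤ s → G s = F₂ s := fun s hs => by simp [hG, hθ1 s hs]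
  have hc₁ : (a₁ + b₁) / 2 < b₁ := by linarith
  have hc₂ : a₂ < (a₂ + b₂) / 2 := by linarith
  set c₁ := (a₁ + b₁) / 2 with hc₁_def
  set c₂ := (a₂ + b₂) / 2 with hc₂_def
  set f : ℝ → ℝ := fun s => if s ≤ c₁ then f₁ s else if c₂ ≤ s then f₂ s else G s with hf
  have hfG : ∀ s, c₁ < s → s < c₂ → f s = G s := fun s hs hs' => by
    simp [hf, hs.not_ge, hs'.not_ge]
  have hfleft : ∀ s ≤ c₁, f s = f₁ s := fun s hs => by simp [hf, hs]
  have hfright : ∀ s, c₂ ≤ s → f s = f₂ s := fun s hs => by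
    simp [hf, hs, (show c₁ < s by linarith).not_ge]
  have hkey : ∀ s ∈ Icc a₁ b₂, ContDiffWithinAt ℝ ∞ f (Icc a₁ b₂) s ∧
      AdmissibleJet (f s) (derivWithin f (Icc a₁ b₂) s)
        (derivWithin (derivWithin f (Icc a₁ b₂)) (Icc a₁ b₂) s) := by
    intro s hs
    rcases le_or_gt s c₁ with hsc₁ | hsc₁
    · have hs₁ : s ∈ Icc a₁ b₁ := ⟨hs.1, by linarith⟩
      refine contDiffWithinAt_and_admissibleJet_congr ?_ ?_ (hf₁ s hs₁) (hadm₁ s hs₁)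
      · filter_upwards [Iio_mem_nhds (show s < c₁ + η₁ by linarith),
          Iio_mem_nhds (show s < b₁ by linarith)] with t ht htb
        rcases le_or_gt t c₁ with h | h
        · exact hfleft t h
        · rw [hfG t h (by linarith [mem_Iio.1 htb]), hGleft t (le_of_lt htb), hmid₁ t]
          rw [abs_lt]
          constructor <;> linarith [mem_Iio.1 ht]
      · rw [eventuallyEq_set]
        filter_upwards [Iio_mem_nhds (show s < b₁ by linarith)] with t ht
        have := mem_Iio.1 ht
        exact ⟨fun h => ⟨h.1, by linarith⟩, fun h => ⟨h.1, by linarith⟩⟩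
    rcases le_or_gt c₂ s with hsc₂ | hsc₂
    · have hs₂ : s ∈ Icc a₂ b₂ := ⟨by linarith, hs.2⟩
      refine contDiffWithinAt_and_admissibleJet_congr ?_ ?_ (hf₂ s hs₂) (hadm₂ s hs₂)
      · filter_upwards [Ioi_mem_nhds (show c₂ - η₂ < s by linarith),
          Ioi_mem_nhds (show a₂ < s by linarith)] with t ht hta
        rcases le_or_gt c₂ t with h | h
        · exact hfright t h
        · rw [hfG t (by linarith [mem_Ioi.1 hta]) h, hGright t (le_of_lt hta), hmid₂ t]
          rw [abs_lt]
          constructor <;> linarith [mem_Ioi.1 ht]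
      · rw [eventuallyEq_set]
        filter_upwards [Ioi_mem_nhds (show a₂ < s by linarith)] with t ht
        have := mem_Ioi.1 ht
        exact ⟨fun h => ⟨by linarith, h.2⟩, fun h => ⟨by linarith, h.2⟩⟩
    have hJ : Icc a₁ b₂ ∈ 𝓝 s := Icc_mem_nhds (by linarith) (by linarith)
    have hfs : f =ᶠ[𝓝 s] G := by
      filter_upwards [Ioo_mem_nhds hsc₁ hsc₂] with t ht using hfG t ht.1 ht.2
    rcases lt_or_ge s b₁ with hsb | hsb
    · have hs₁ : s ∈ Icc a₁ b₁ := ⟨hs.1, hsb.le⟩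
      obtain ⟨hx, hy, hz⟩ := hclose₁ s hs₁
      refine contDiffWithinAt_and_admissibleJet_of_hasDerivAt (hfs.trans ?_) hJ hF₁ hdF₁ hdF₁'
        (hnear₁ s hs₁ _ _ _ (hx.trans_lt hεε₁) (hy.trans_lt hεε₁) (by linarith))
      filter_upwards [Iio_mem_nhds hsb] with t ht using hGleft t (le_of_lt ht)
    rcases lt_or_ge a₂ s with hsa | hsa
    · have hs₂ : s ∈ Icc a₂ b₂ := ⟨hsa.le, hs.2⟩
      obtain ⟨hx, hy, hz⟩ := hclose₂ s hs₂
      refine contDiffWithinAt_and_admissibleJet_of_hasDerivAt (hfs.trans ?_) hJ hF₂ hdF₂ hdF₂'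
        (hnear₂ s hs₂ _ _ _ (hx.trans_lt hεε₂) (hy.trans_lt hεε₂) (by linarith))
      filter_upwards [Ioi_mem_nhds hsa] with t ht using hGright t (le_of_lt ht)
    exact contDiffWithinAt_and_admissibleJet_of_hasDerivAt hfs hJ hGsmooth hdG hdG'
      (hGadm s ⟨hsb, hsa⟩)
  exact ⟨f, fun s hs => (hkey s hs).1, fun s hs => ⟨(hkey s hs).2.1, (hkey s hs).2.2.1⟩,
    fun s hs => hfleft s hs.2, fun s hs => hfright s hs.1, fun s hs => (hkey s hs).2.2.2⟩
end

section
/- Let $f : [a,b] \to \mathbb{R}$ be a smooth function with $f > 0$ and $f' > 0$ on $[a,b]$, such that: (a) $1 - f'(s)^2 - 2 f(s) f''(s) > 0$ for all $s \in [a,b]$; and (b) $\tfrac{f(b)}{2}(1 - f'(b)^2) \geq 0$, i.e. $f'(b) \leq 1$. Then for every real number $m > \tfrac{f(b)}{2}(1 - f'(b)^2)$ there exist $c > b$ and a smooth function $\tilde f : [a,\infty) \to \mathbb{R}$ such that: (A) $\tilde f = f$ on $[a,b]$; (B) $\tilde f > 0$ and $\tilde f' > 0$ on $[a,\infty)$;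 (C) $1 - \tilde f'(s)^2 - 2 \tilde f(s) \tilde f''(s) \geq 0$ for all $s \in [a,\infty)$; and (D) for all $s \geq c$ one has $\tilde f(s) > 2m$ and $\tilde f'(s) = \sqrt{1 - 2m/\tilde f(s)}$. -/
open Set


/-- A compactly supported smooth function whose Taylor series at `0` is a single monomial, with
all derivatives of order less than the degree uniformly small. -/
lemma exists_contDiff_monomial_jet (n : ℕ) (α δ : ℝ) (hδ : 0 < δ) :
    ∃ h : ℝ → ℝ, ContDiff ℝ (⊤ : ℕ∞) h ∧ HasCompactSupport h ∧
      (∀ k, iteratedDeriv k h 0 = if k = n then α else 0) ∧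
      ∀ k < n, ∀ x, |iteratedDeriv k h x| ≤ δ := by
  let χ : ContDiffBump (0 : ℝ) := ⟨1, 2, one_pos, one_lt_two⟩
  let ψ : ℝ → ℝ := fun y => y ^ n * χ y
  have hψ : ContDiff ℝ (⊤ : ℕ∞) ψ := (contDiff_id.pow n).mul χ.contDiff
  have hψc : HasCompactSupport ψ := χ.hasCompactSupport.mul_left
  have hbound : ∀ k, ∃ C, ∀ x, |iteratedDeriv k ψ x| ≤ C := by
    intro k
    obtain ⟨C, hC⟩ := (hψc.iteratedFDeriv (𝕜 := ℝ) k).exists_bound_of_continuous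
      (hψ.continuous_iteratedFDeriv (by exact_mod_cast le_top))
    exact ⟨C, fun x => by
      rw [← Real.norm_eq_abs, ← norm_iteratedFDeriv_eq_norm_iteratedDeriv]; exact hC x⟩
  choose C hC using hbound
  have hC0 : ∀ k, 0 ≤ C k := fun k => (abs_nonneg _).trans (hC k 0)
  let B : ℝ := ∑ k ∈ Finset.range n, C k
  have hB0 : 0 ≤ B := Finset.sum_nonneg fun k _ => hC0 k
  let β : ℝ := α / n.factorial
  let ε : ℝ := min 1 (δ / (|β| * B + 1))
  have hden : 0 < |β| * B + 1 := by positivity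
  have hε : 0 < ε := lt_min one_pos (div_pos hδ hden)
  have hε1 : ε ≤ 1 := min_le_left _ _
  have hεδ : ε * (|β| * B) ≤ δ := by
    have h1 : ε * (|β| * B + 1) ≤ δ := by
      have := min_le_right 1 (δ / (|β| * B + 1))
      rwa [le_div_iff₀ hden] at this
    nlinarith
  have hsc : ContDiff ℝ (⊤ : ℕ∞) (fun x => ψ (ε⁻¹ * x)) := hψ.comp (contDiff_const.mul contDiff_id)
  have hder : ∀ k x, iteratedDeriv k (fun x => β * ε ^ n * ψ (ε⁻¹ * x)) x
      = β * ε ^ n * (ε⁻¹ ^ k * iteratedDeriv k ψ (ε⁻¹ * x)) := by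
    intro k x
    rw [iteratedDeriv_const_mul_field, iteratedDeriv_comp_const_mul
      (hψ.of_le (by exact_mod_cast le_top))]
  have hψ0 : ∀ k, iteratedDeriv k ψ 0 = if k = n then (n.factorial : ℝ) else 0 := by
    intro k
    have : ψ =ᶠ[nhds 0] fun y => y ^ n := by
      filter_upwards [χ.eventuallyEq_one] with y hy
      simp [ψ, hy]
    rw [this.iteratedDeriv_eq, iteratedDeriv_fun_pow_zero]
    split_ifs <;> simp
  refine ⟨fun x => β * ε ^ n * ψ (ε⁻¹ * x), contDiff_const.mul hsc, ?_, ?_, ?_⟩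
  · exact (hψc.comp_homeomorph (Homeomorph.mulLeft₀ ε⁻¹ (inv_ne_zero hε.ne'))).mul_left
  · intro k
    rw [hder, mul_zero, hψ0]
    split_ifs with h
    · subst h
      have : (k.factorial : ℝ) ≠ 0 := by positivity
      simp only [β, inv_pow]
      field_simp
    · simp
  · intro k hk x
    rw [hder]
    have e : β * ε ^ n * (ε⁻¹ ^ k * iteratedDeriv k ψ (ε⁻¹ * x))
        = β * (ε ^ (n - k) * iteratedDeriv k ψ (ε⁻¹ * x)) := by
      have : ε ^ n = ε ^ (n - k) * ε ^ k := by rw [← pow_add]; congr 1; omega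
      rw [this, inv_pow]; field_simp
    rw [e, abs_mul, abs_mul, abs_of_nonneg (pow_nonneg hε.le _)]
    have h1 : ε ^ (n - k) ≤ ε := pow_le_of_le_one hε.le hε1 (by omega)
    have h2 : |iteratedDeriv k ψ (ε⁻¹ * x)| ≤ B :=
      (hC k _).trans (Finset.single_le_sum (fun i _ => hC0 i) (Finset.mem_range.2 hk))
    calc |β| * (ε ^ (n - k) * |iteratedDeriv k ψ (ε⁻¹ * x)|) ≤ |β| * (ε * B) := by gcongr
      _ = ε * (|β| * B) := by ring
      _ ≤ δ := hεδ

/-- **Borel's lemma**: every real sequence is the sequence of derivatives at a given point of a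
smooth function. -/
theorem exists_contDiff_iteratedDeriv_eq (α : ℕ → ℝ) (c : ℝ) :
    ∃ F : ℝ → ℝ, ContDiff ℝ (⊤ : ℕ∞) F ∧ ∀ k, iteratedDeriv k F c = α k := by
  choose h hsm hcs hjet hsmall using fun n =>
    exists_contDiff_monomial_jet n (α n) ((1 / 2) ^ n) (by positivity)
  have hbound : ∀ k i, ∃ C, ∀ x, ‖iteratedFDeriv ℝ k (h i) x‖ ≤ C := fun k i =>
    ((hcs i).iteratedFDeriv (𝕜 := ℝ) k).exists_bound_of_continuous
      ((hsm i).continuous_iteratedFDeriv (by exact_mod_cast le_top))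
  choose C hC using hbound
  have hC0 : ∀ k i, 0 ≤ C k i := fun k i => (norm_nonneg _).trans (hC k i 0)
  let v : ℕ → ℕ → ℝ := fun k i => (1 / 2) ^ i + if i ≤ k then C k i else 0
  have hv : ∀ k : ℕ, (k : ℕ∞) ≤ ⊤ → Summable (v k) := fun k _ => by
    refine summable_geometric_two.add
      (summable_of_ne_finset_zero (s := Finset.range (k + 1)) fun i hi => if_neg ?_)
    simpa [Nat.lt_succ_iff] using hi
  have hle : ∀ (k i : ℕ) (x : ℝ), (k : ℕ∞) ≤ ⊤ → ‖iteratedFDeriv ℝ k (h i) x‖ ≤ v k i := by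
    intro k i x _
    rcases le_or_gt i k with hik | hik
    · simp only [v, if_pos hik]
      have := hC k i x
      have : (0 : ℝ) ≤ (1 / 2) ^ i := by positivity
      linarith
    · simp only [v, if_neg hik.not_ge, add_zero]
      rw [norm_iteratedFDeriv_eq_norm_iteratedDeriv]
      exact hsmall i k hik x
  have hF := contDiff_tsum hsm hv hle
  refine ⟨fun x => ∑' i, h i (x - c), hF.comp (contDiff_id.sub contDiff_const), fun k => ?_⟩
  rw [iteratedDeriv_comp_sub_const (f := fun x => ∑' i, h i x)]
  simp only [sub_self]
  rw [iteratedDeriv_eq_iteratedFDeriv, iteratedFDeriv_tsum_apply hsm hv hle le_top,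
    tsum_eq_single k, ← iteratedDeriv_eq_iteratedFDeriv, hjet, if_pos rfl]
  intro i hi
  rw [← norm_eq_zero, norm_iteratedFDeriv_eq_norm_iteratedDeriv, hjet, if_neg hi.symm, norm_zero]

/-- If `s` lies to the left and `t` to the right of `c`, a function differentiable within both with
the same one-sided derivatives at `c` is differentiable within the union. -/
lemma hasDerivWithinAt_union_of_le {s t : Set ℝ} {c : ℝ} {w d : ℝ → ℝ}
    (hs : s ⊆ Iic c) (ht : t ⊆ Ici c) (hws : ∀ x ∈ s, HasDerivWithinAt w (d x) s x)
    (hwt : ∀ x ∈ t, HasDerivWithinAt w (d x) t x) (hcs : c ∈ s) (hct : c ∈ t) :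
    ∀ x ∈ s ∪ t, HasDerivWithinAt w (d x) (s ∪ t) x := by
  intro x hx
  have hs' : closure s ⊆ Iic c := closure_minimal hs isClosed_Iic
  have ht' : closure t ⊆ Ici c := closure_minimal ht isClosed_Ici
  rcases lt_trichotomy x c with h | h | h
  · have hxs : x ∈ s := hx.resolve_right fun hxt => (ht hxt).not_gt h
    exact (hws x hxs).union (HasFDerivWithinAt.of_notMem_closure fun hxt => (ht' hxt).not_gt h)
  · subst h
    exact (hws x hcs).union (hwt x hct)
  · have hxt : x ∈ t := hx.resolve_left fun hxs => (hs hxs).not_gt h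
    exact HasDerivWithinAt.union
      (HasFDerivWithinAt.of_notMem_closure fun hxs => (hs' hxs).not_gt h) (hwt x hxt)

lemma contDiffOn_nat_union_of_le {s t : Set ℝ} {c : ℝ} (hs : s ⊆ Iic c) (ht : t ⊆ Ici c)
    (hcs : c ∈ s) (hct : c ∈ t) (us : UniqueDiffOn ℝ s) (ut : UniqueDiffOn ℝ t) (n : ℕ) :
    ∀ w : ℝ → ℝ, ContDiffOn ℝ n w s → ContDiffOn ℝ n w t →
      (∀ k ≤ n, iteratedDerivWithin k w s c = iteratedDerivWithin k w t c) →
      ContDiffOn ℝ n w (s ∪ t) := by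
  have ust : UniqueDiffOn ℝ (s ∪ t) := by
    rintro x (hx | hx)
    · exact (us x hx).mono subset_union_left
    · exact (ut x hx).mono subset_union_right
  induction n with
  | zero =>
    intro w hws hwt _
    simp only [CharP.cast_eq_zero, contDiffOn_zero] at hws hwt ⊢
    have hs' : closure s ⊆ Iic c := closure_minimal hs isClosed_Iic
    have ht' : closure t ⊆ Ici c := closure_minimal ht isClosed_Ici
    intro x hx
    rcases lt_trichotomy x c with h | h | h
    · have hxs : x ∈ s := hx.resolve_right fun hxt => (ht hxt).not_gt h
      exact (hws x hxs).union
        (continuousWithinAt_of_notMem_closure fun hxt => (ht' hxt).not_gt h)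
    · subst h
      exact (hws x hcs).union (hwt x hct)
    · have hxt : x ∈ t := hx.resolve_left fun hxs => (hs hxs).not_gt h
      exact ContinuousWithinAt.union
        (continuousWithinAt_of_notMem_closure fun hxs => (hs' hxs).not_gt h) (hwt x hxt)
  | succ n ih =>
    intro w hws hwt hk
    push_cast at hws hwt ⊢
    rw [contDiffOn_succ_iff_derivWithin us] at hws
    rw [contDiffOn_succ_iff_derivWithin ut] at hwt
    rw [contDiffOn_succ_iff_derivWithin ust]
    have hc : derivWithin w s c = derivWithin w t c := by
      simpa [iteratedDerivWithin_one] using hk 1 (by omega)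
    let d : ℝ → ℝ := fun x => if x ≤ c then derivWithin w s x else derivWithin w t x
    have hds : EqOn d (derivWithin w s) s := fun x hx => if_pos (hs hx)
    have hdt : EqOn d (derivWithin w t) t := by
      intro x hx
      rcases (show c ≤ x from ht hx).eq_or_lt with h | h
      · subst h; simpa [d] using hc
      · exact if_neg h.not_ge
    have hd := hasDerivWithinAt_union_of_le (d := d) hs ht
      (fun x hx => by rw [hds hx]; exact (hws.1 x hx).hasDerivWithinAt)
      (fun x hx => by rw [hdt hx]; exact (hwt.1 x hx).hasDerivWithinAt) hcs hct
    refine ⟨fun x hx => (hd x hx).differentiableWithinAt, by simp, ?_⟩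
    refine ContDiffOn.congr (f := d) ?_ fun x hx => (hd x hx).derivWithin (ust x hx)
    refine ih d (hws.2.2.congr hds) (hwt.2.2.congr hdt) fun k hkn => ?_
    rw [iteratedDerivWithin_congr hds hcs, iteratedDerivWithin_congr hdt hct,
      ← iteratedDerivWithin_succ', ← iteratedDerivWithin_succ']
    exact hk (k + 1) (by omega)

/-- A function that is smooth on a set to the left of `c` and on a set to the right of `c` is smooth
on their union as soon as all its one-sided derivatives at `c` agree. -/
lemma contDiffOn_infty_union_of_le {s t : Set ℝ} {c : ℝ} (hs : s ⊆ Iic c) (ht : t ⊆ Ici c)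
    (hcs : c ∈ s) (hct : c ∈ t) (us : UniqueDiffOn ℝ s) (ut : UniqueDiffOn ℝ t) {w : ℝ → ℝ}
    (hws : ContDiffOn ℝ (⊤ : ℕ∞) w s) (hwt : ContDiffOn ℝ (⊤ : ℕ∞) w t)
    (hk : ∀ k, iteratedDerivWithin k w s c = iteratedDerivWithin k w t c) :
    ContDiffOn ℝ (⊤ : ℕ∞) w (s ∪ t) := by
  rw [contDiffOn_infty] at hws hwt ⊢
  exact fun n => contDiffOn_nat_union_of_le hs ht hcs hct us ut n w (hws n) (hwt n)
    fun k _ => hk k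

/-- A smooth function on a compact interval extends to a smooth function on the line. -/
theorem exists_contDiff_eqOn_Icc {a b : ℝ} (hab : a < b) {f : ℝ → ℝ}
    (hf : ContDiffOn ℝ (⊤ : ℕ∞) f (Icc a b)) :
    ∃ F : ℝ → ℝ, ContDiff ℝ (⊤ : ℕ∞) F ∧ EqOn F f (Icc a b) := by
  obtain ⟨Q, hQ, hQk⟩ := exists_contDiff_iteratedDeriv_eq
    (fun k => iteratedDerivWithin k f (Icc a b) b) b
  let w : ℝ → ℝ := fun x => if x ≤ b then f x else Q x
  have hwf : EqOn w f (Icc a b) := fun x hx => if_pos hx.2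
  have hwQ : EqOn w Q (Ici b) := by
    intro x hx
    rcases (show b ≤ x from hx).eq_or_lt with h | h
    · subst h; simpa [w] using (hQk 0).symm
    · exact if_neg h.not_ge
  have hw : ContDiffOn ℝ (⊤ : ℕ∞) w (Icc a b ∪ Ici b) := by
    refine contDiffOn_infty_union_of_le (c := b) Icc_subset_Iic_self subset_rfl
      (right_mem_Icc.2 hab.le) self_mem_Ici (uniqueDiffOn_Icc hab) (uniqueDiffOn_Ici b)
      (hf.congr hwf) (hQ.contDiffOn.congr hwQ) fun k => ?_
    rw [iteratedDerivWithin_congr hwf (right_mem_Icc.2 hab.le),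
      iteratedDerivWithin_congr hwQ self_mem_Ici, iteratedDerivWithin_eq_iteratedDeriv
        (uniqueDiffOn_Ici b) (hQ.of_le (by exact_mod_cast le_top)).contDiffAt self_mem_Ici, hQk]
  rw [Icc_union_Ici_eq_Ici hab.le] at hw
  obtain ⟨P, hP, hPk⟩ := exists_contDiff_iteratedDeriv_eq
    (fun k => iteratedDerivWithin k w (Ici a) a) a
  let F : ℝ → ℝ := fun x => if x ≤ a then P x else w x
  have hFP : EqOn F P (Iic a) := fun x hx => if_pos hx
  have hFw : EqOn F w (Ici a) := by
    intro x hx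
    rcases (show a ≤ x from hx).eq_or_lt with h | h
    · subst h; simpa [F] using hPk 0
    · exact if_neg h.not_ge
  have hF : ContDiffOn ℝ (⊤ : ℕ∞) F (Iic a ∪ Ici a) := by
    refine contDiffOn_infty_union_of_le (c := a) subset_rfl subset_rfl
      self_mem_Iic self_mem_Ici (uniqueDiffOn_Iic a) (uniqueDiffOn_Ici a)
      (hP.contDiffOn.congr hFP) (hw.congr hFw) fun k => ?_
    rw [iteratedDerivWithin_congr hFP self_mem_Iic,
      iteratedDerivWithin_congr hFw self_mem_Ici, iteratedDerivWithin_eq_iteratedDeriv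
        (uniqueDiffOn_Iic a) (hP.of_le (by exact_mod_cast le_top)).contDiffAt self_mem_Iic, hPk]
  rw [Iic_union_Ici, contDiffOn_univ] at hF
  exact ⟨F, hF, fun x hx => (hFw hx.1).trans (hwf hx)⟩

lemma exists_smooth_step {p q : ℝ} (hpq : p < q) :
    ∃ β : ℝ → ℝ, ContDiff ℝ (⊤ : ℕ∞) β ∧ Monotone β ∧ (∀ t, 0 ≤ β t) ∧ (∀ t, β t ≤ 1) ∧
      (∀ t ≤ p, β t = 0) ∧ ∀ t, q ≤ t → β t = 1 := by
  have h : 0 < q - p := sub_pos.2 hpq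
  refine ⟨fun t => Real.smoothTransition ((t - p) / (q - p)), ?_, ?_, fun t =>
    Real.smoothTransition.nonneg _, fun t => Real.smoothTransition.le_one _, fun t ht => ?_,
    fun t ht => ?_⟩
  · exact Real.smoothTransition.contDiff.comp ((contDiff_id.sub contDiff_const).div_const _)
  · intro x y hxy
    exact Real.smoothTransition.monotone (by gcongr)
  · exact Real.smoothTransition.zero_of_nonpos (div_nonpos_of_nonpos_of_nonneg (by linarith) h.le)
  · exact Real.smoothTransition.one_of_one_le ((one_le_div h).2 (by linarith))

lemma exists_forall_Icc_of_eventually {b : ℝ} {p : ℝ → Prop} (h : ∀ᶠ t in nhds b, p t) :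
    ∃ δ > 0, ∀ t ∈ Icc b (b + δ), p t := by
  obtain ⟨ε, hε, H⟩ := Metric.eventually_nhds_iff.1 h
  refine ⟨ε / 2, by positivity, fun t ht => H ?_⟩
  rw [Real.dist_eq, abs_lt]
  constructor <;> linarith [ht.1, ht.2]

/-- A smooth function increasing on `[a, b]` can be changed beyond `b` so as to be increasing and
unbounded on `[a, ∞)`. -/
lemma exists_increasing_continuation {a b : ℝ} (hab : a < b) {F₀ : ℝ → ℝ}
    (hF₀ : ContDiff ℝ (⊤ : ℕ∞) F₀) (hpos : ∀ t ∈ Icc a b, 0 < deriv F₀ t) :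
    ∃ F : ℝ → ℝ, ContDiff ℝ (⊤ : ℕ∞) F ∧ EqOn F F₀ (Iic b) ∧ (∀ t, a ≤ t → 0 < deriv F t) ∧
      Filter.Tendsto F Filter.atTop Filter.atTop := by
  have hF₀d : Differentiable ℝ F₀ := (contDiff_infty_iff_deriv.1 hF₀).1
  have hF₀c : Continuous (deriv F₀) := (contDiff_infty_iff_deriv.1 hF₀).2.continuous
  obtain ⟨δ, hδ, hδpos⟩ := exists_forall_Icc_of_eventually
    (hF₀c.continuousAt.eventually_const_lt (hpos b (right_mem_Icc.2 hab.le)))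
  have hpos' : ∀ t ∈ Icc a (b + δ), 0 < deriv F₀ t := fun t ht =>
    (le_total t b).elim (fun h => hpos t ⟨ht.1, h⟩) fun h => hδpos t ⟨h, ht.2⟩
  have hmono : StrictMonoOn F₀ (Icc a (b + δ)) :=
    strictMonoOn_of_deriv_pos (convex_Icc _ _) hF₀d.continuous.continuousOn fun t ht =>
      hpos' t (interior_subset ht)
  obtain ⟨β, hβ, hβm, hβ0, hβ1, hβl, hβr⟩ := exists_smooth_step (lt_add_of_pos_right b hδ)
  have hβd : Differentiable ℝ β := (contDiff_infty_iff_deriv.1 hβ).1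
  let L : ℝ → ℝ := fun t => t - b + F₀ (b + δ)
  have hLd : ∀ t, HasDerivAt L 1 t := fun t => ((hasDerivAt_id t).sub_const b).add_const _
  have hL : ContDiff ℝ (⊤ : ℕ∞) L := (contDiff_id.sub contDiff_const).add contDiff_const
  let F : ℝ → ℝ := fun t => F₀ t + β t * (L t - F₀ t)
  have hFd : ∀ t, deriv F t =
      deriv F₀ t + (deriv β t * (L t - F₀ t) + β t * (1 - deriv F₀ t)) := fun t =>
    ((hF₀d t).hasDerivAt.add
      ((hβd t).hasDerivAt.mul ((hLd t).sub (hF₀d t).hasDerivAt))).deriv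
  refine ⟨F, hF₀.add (hβ.mul (hL.sub hF₀)), fun t ht => by simp [F, hβl t ht], fun t ht => ?_, ?_⟩
  · rw [hFd]
    rcases lt_or_ge t (b + δ) with h | h
    · have h1 : 0 ≤ deriv β t * (L t - F₀ t) := by
        rcases lt_or_ge t b with hb | hb
        · have : deriv β t = 0 := by
            have : β =ᶠ[nhds t] fun _ => 0 := by
              filter_upwards [Iio_mem_nhds hb] with y hy using hβl y (le_of_lt hy)
            rw [this.deriv_eq, deriv_const]
          simp [this]
        · refine mul_nonneg hβm.deriv_nonneg ?_
          have : F₀ t ≤ F₀ (b + δ) :=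
            hmono.monotoneOn ⟨ht, h.le⟩ ⟨by linarith, le_rfl⟩ h.le
          simp only [L]; linarith
      have h2 := hpos' t ⟨ht, h.le⟩
      rcases (hβ1 t).eq_or_lt with h3 | h3
      · rw [h3]; linarith
      · nlinarith [hβ0 t, mul_pos (sub_pos.2 h3) h2]
    · have h1 : deriv β t = 0 := by
        refine IsLocalMax.deriv_eq_zero (Filter.Eventually.of_forall fun y => ?_)
        rw [hβr t h]; exact hβ1 y
      rw [h1, hβr t h]; linarith
  · have : F =ᶠ[Filter.atTop] L := by
      filter_upwards [Filter.eventually_ge_atTop (b + δ)] with t ht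
      simp [F, hβr t ht]
    refine Filter.Tendsto.congr' this.symm ?_
    exact Filter.tendsto_atTop_add_const_right _ _
      (Filter.tendsto_atTop_add_const_right _ _ Filter.tendsto_id)

/-- Convex interpolation from a monotone function below `m` to the constant `m`. -/
lemma monotoneOn_add_mul_sub {s : Set ℝ} {β M : ℝ → ℝ} {m q : ℝ} (hβm : Monotone β)
    (hβ1 : ∀ t, β t ≤ 1) (hβr : ∀ t, q ≤ t → β t = 1) (hM : MonotoneOn M (s ∩ Iic q))
    (hMm : ∀ t ∈ s ∩ Iic q, M t ≤ m) :
    MonotoneOn (fun t => M t + β t * (m - M t)) s := by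
  intro x hx y hy hxy
  have key : ∀ t, M t + β t * (m - M t) = m - (1 - β t) * (m - M t) := fun t => by ring
  simp only [key]
  rcases le_total q y with h | h
  · rw [hβr y h]
    rcases le_total q x with h' | h'
    · rw [hβr x h']; simp
    · nlinarith [mul_nonneg (sub_nonneg.2 (hβ1 x)) (sub_nonneg.2 (hMm x ⟨hx, h'⟩))]
  · have hx' : x ∈ s ∩ Iic q := ⟨hx, hxy.trans h⟩
    have h1 : (1 - β y) * (m - M y) ≤ (1 - β x) * (m - M x) :=
      mul_le_mul (by linarith [hβm hxy]) (by linarith [hM hx' ⟨hy, h⟩ hxy])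
        (sub_nonneg.2 (hMm y ⟨hy, h⟩)) (sub_nonneg.2 (hβ1 x))
    linarith

/-- A smooth mass function that is monotone on `[a, b]` and strictly increasing at `b` can be
continued monotonically beyond `b` to any larger constant value without ever exceeding half
the area radius `F`. -/
lemma exists_mass_continuation {a b m : ℝ} (hab : a < b) {F M₀ : ℝ → ℝ}
    (hF : MonotoneOn F (Ici a)) (hFlim : Filter.Tendsto F Filter.atTop Filter.atTop)
    (hM₀ : ContDiff ℝ (⊤ : ℕ∞) M₀) (hM₀' : ∀ t ∈ Icc a b, 0 < deriv M₀ t)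
    (hM₀F : ∀ t, a ≤ t → 2 * M₀ t < F t) (hm : M₀ b < m) :
    ∃ M : ℝ → ℝ, ContDiff ℝ (⊤ : ℕ∞) M ∧ EqOn M M₀ (Iic b) ∧ MonotoneOn M (Ici a) ∧
      (∀ t, a ≤ t → 2 * M t < F t) ∧ ∃ T, b < T ∧ ∀ t, T ≤ t → M t = m := by
  obtain ⟨hM₀d, hM₀c⟩ := contDiff_infty_iff_deriv.1 hM₀
  obtain ⟨m₁, hm₁, hm₁'⟩ : ∃ m₁, M₀ b < m₁ ∧ m₁ < min m (F b / 2) :=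
    exists_between (lt_min hm (by linarith [hM₀F b hab.le]))
  obtain ⟨hm₁m, hm₁F⟩ := lt_min_iff.1 hm₁'
  obtain ⟨δ, hδ, hδb⟩ := exists_forall_Icc_of_eventually
    ((hM₀c.continuous.continuousAt.eventually_const_lt (hM₀' b (right_mem_Icc.2 hab.le))).and
      (hM₀d.continuous.continuousAt.eventually_lt_const hm₁))
  have hpos : ∀ t ∈ Icc a (b + δ), 0 < deriv M₀ t := fun t ht =>
    (le_total t b).elim (fun h => hM₀' t ⟨ht.1, h⟩) fun h => (hδb t ⟨h, ht.2⟩).1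
  have hmono : MonotoneOn M₀ (Icc a (b + δ)) :=
    (strictMonoOn_of_deriv_pos (convex_Icc _ _) hM₀d.continuous.continuousOn fun t ht =>
      hpos t (interior_subset ht)).monotoneOn
  have hle : ∀ t ∈ Icc a (b + δ), M₀ t ≤ m₁ := fun t ht =>
    (hmono ht ⟨by linarith, le_rfl⟩ ht.2).trans (hδb _ ⟨by linarith, le_rfl⟩).2.le
  obtain ⟨β, hβ, hβm, hβ0, hβ1, hβl, hβr⟩ := exists_smooth_step (lt_add_of_pos_right b hδ)
  let M₁ : ℝ → ℝ := fun t => M₀ t + β t * (m₁ - M₀ t)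
  have hM₁ : ContDiff ℝ (⊤ : ℕ∞) M₁ := hM₀.add (hβ.mul (contDiff_const.sub hM₀))
  have hM₁mono : MonotoneOn M₁ (Ici a) := by
    refine monotoneOn_add_mul_sub hβm hβ1 hβr ?_ ?_ <;> rw [Ici_inter_Iic]
    exacts [hmono, hle]
  have hM₁le : ∀ t, a ≤ t → M₁ t ≤ m₁ := fun t ht => by
    have h1 : M₁ t ≤ M₁ (max t (b + δ)) := hM₁mono ht (ht.trans (le_max_left _ _)) (le_max_left _ _)
    have h2 : M₁ (max t (b + δ)) = m₁ := by simp [M₁, hβr _ (le_max_right t (b + δ))]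
    exact h1.trans h2.le
  have hM₁F : ∀ t, a ≤ t → 2 * M₁ t < F t := fun t ht => by
    rcases le_total t b with h | h
    · simpa [M₁, hβl t h] using hM₀F t ht
    · have := hF hab.le ht h
      linarith [hM₁le t ht]
  obtain ⟨T, hT, hTb⟩ := ((hFlim.eventually_gt_atTop (2 * m)).and
    (Filter.eventually_gt_atTop b)).exists
  obtain ⟨η, hη, hηm, hη0, hη1, hηl, hηr⟩ := exists_smooth_step (lt_add_one T)
  refine ⟨fun t => M₁ t + η t * (m - M₁ t), hM₁.add (hη.mul (contDiff_const.sub hM₁)), ?_, ?_, ?_,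
    T + 1, by linarith, fun t ht => by simp [hηr t ht]⟩
  · intro t ht
    have ht' : t ≤ b := ht
    simp [M₁, hβl t ht', hηl t (ht'.trans hTb.le)]
  · exact monotoneOn_add_mul_sub hηm hη1 hηr (hM₁mono.mono inter_subset_left)
      fun t ht => (hM₁le t ht.1).trans hm₁m.le
  · intro t ht
    rcases le_total t T with h | h
    · simpa [hηl t h] using hM₁F t ht
    · have h1 : F T ≤ F t := hF (hab.le.trans hTb.le) ht h
      have h2 := hM₁le t ht
      simp only
      nlinarith [mul_nonneg (sub_nonneg.2 (hη1 t)) (show 0 ≤ m - M₁ t by linarith)]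

/-- A smooth function with positive derivative, tending to infinity and equal to the identity
near `-∞`, has a smooth inverse. -/
lemma exists_smooth_inverse {K k : ℝ → ℝ} {b : ℝ} (hK : ContDiff ℝ (⊤ : ℕ∞) K)
    (hKd : ∀ t, HasDerivAt K (k t) t) (hk : ∀ t, 0 < k t) (hKb : ∀ t ≤ b, K t = t)
    (hKlim : Filter.Tendsto K Filter.atTop Filter.atTop) :
    ∃ θ : ℝ → ℝ, ContDiff ℝ (⊤ : ℕ∞) θ ∧ StrictMono θ ∧ (∀ t, θ (K t) = t) ∧
      ∀ s, HasDerivAt θ (k (θ s))⁻¹ s := by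
  have hmono : StrictMono K := strictMono_of_deriv_pos fun t => by rw [(hKd t).deriv]; exact hk t
  have hbot : Filter.Tendsto K Filter.atBot Filter.atBot := by
    refine Filter.tendsto_id.congr' ?_
    filter_upwards [Filter.eventually_le_atBot b] with t ht using (hKb t ht).symm
  have hsurj : Function.Surjective K := hK.continuous.surjective hKlim hbot
  let e : ℝ ≃o ℝ := hmono.orderIsoOfSurjective K hsurj
  have hθ : ContDiff ℝ (⊤ : ℕ∞) e.symm :=
    e.toHomeomorph.contDiff_symm_deriv (fun t => (hk t).ne') hKd hK
  refine ⟨e.symm, hθ, e.symm.strictMono, fun t => e.symm_apply_apply t, fun s => ?_⟩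
  exact (hKd _).of_local_left_inverse hθ.continuous.continuousAt (hk _).ne'
    (Filter.Eventually.of_forall fun y => e.apply_symm_apply y)

lemma ContDiff.derivWithin_derivWithin_eq {F : ℝ → ℝ} (hF : ContDiff ℝ (⊤ : ℕ∞) F) {s : Set ℝ}
    (hs : UniqueDiffOn ℝ s) {x : ℝ} (hx : x ∈ s) :
    derivWithin (derivWithin F s) s x = deriv (deriv F) x := by
  have h : EqOn (derivWithin F s) (deriv F) s := fun y hy =>
    (hF.differentiable (by simp) y).derivWithin (hs y hy)
  rw [derivWithin_congr h (h hx)]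
  exact ((contDiff_infty_iff_deriv.1 hF).2.differentiable (by simp) x).derivWithin (hs x hx)

/-- The Hawking mass of the sphere at `s` in the warped product with radial profile `F`. -/
noncomputable def hawkingMass (F : ℝ → ℝ) (s : ℝ) : ℝ := F s / 2 * (1 - deriv F s ^ 2)

lemma contDiff_hawkingMass {F : ℝ → ℝ} (hF : ContDiff ℝ (⊤ : ℕ∞) F) :
    ContDiff ℝ (⊤ : ℕ∞) (hawkingMass F) :=
  (hF.div_const 2).mul (contDiff_const.sub ((contDiff_infty_iff_deriv.1 hF).2.pow 2))

lemma hasDerivAt_hawkingMass {F : ℝ → ℝ} (hF : ContDiff ℝ (⊤ : ℕ∞) F) (s : ℝ) :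
    HasDerivAt (hawkingMass F)
      (deriv F s / 2 * (1 - deriv F s ^ 2 - 2 * F s * deriv (deriv F) s)) s := by
  obtain ⟨h1, h2⟩ := contDiff_infty_iff_deriv.1 hF
  have h3 := ((contDiff_infty_iff_deriv.1 h2).1 s).hasDerivAt
  have := ((h1 s).hasDerivAt.div_const 2).mul ((h3.pow 2).const_sub 1)
  refine this.congr_deriv ?_
  simp only [Nat.cast_ofNat, Nat.add_one_sub_one, pow_one, Pi.pow_apply]
  ring

/-- Reparametrising a profile `F` so that its Hawking mass becomes a prescribed function `M`. -/
lemma exists_profile_of_mass {a b : ℝ} (hab : a < b) {F M : ℝ → ℝ} (hF : ContDiff ℝ (⊤ : ℕ∞) F)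
    (hFa : 0 < F a) (hF' : ∀ t, a ≤ t → 0 < deriv F t)
    (hFlim : Filter.Tendsto F Filter.atTop Filter.atTop) (hM : ContDiff ℝ (⊤ : ℕ∞) M)
    (hMb : EqOn M (hawkingMass F) (Iic b)) (hMF : ∀ t, a ≤ t → 2 * M t < F t)
    (hM0 : ∀ t, b ≤ t → 0 ≤ M t) :
    ∃ θ : ℝ → ℝ, ContDiff ℝ (⊤ : ℕ∞) θ ∧ StrictMono θ ∧ (∀ t ≤ b, θ t = t) ∧
      Filter.Tendsto θ Filter.atTop Filter.atTop ∧
      ∀ s, a ≤ s → deriv (F ∘ θ) s = √(1 - 2 * M (θ s) / F (θ s)) := by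
  obtain ⟨hFd, hFc⟩ := contDiff_infty_iff_deriv.1 hF
  have hFmono : MonotoneOn F (Ici a) :=
    (strictMonoOn_of_deriv_pos (convex_Ici a) hF.continuous.continuousOn fun t ht =>
      hF' t (interior_subset ht)).monotoneOn
  have hFpos : ∀ t, a ≤ t → 0 < F t := fun t ht => hFa.trans_le (hFmono self_mem_Ici ht ht)
  have hrad : ∀ t, a ≤ t → 0 < 1 - 2 * M t / F t := fun t ht => by
    rw [sub_pos, div_lt_one (hFpos t ht)]; exact hMF t ht
  have hsqrt : ∀ t ∈ Icc a b, √(1 - 2 * M t / F t) = deriv F t := fun t ht => by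
    have h1 := (hFpos t ht.1).ne'
    have : 1 - 2 * M t / F t = deriv F t ^ 2 := by
      rw [hMb ht.2, hawkingMass]; field_simp; ring
    rw [this, Real.sqrt_sq (hF' t ht.1).le]
  let k : ℝ → ℝ := fun t => if t ≤ b then 1 else deriv F t / √(1 - 2 * M t / F t)
  have hka : ∀ t, a ≤ t → k t = deriv F t / √(1 - 2 * M t / F t) := fun t ht => by
    rcases le_or_gt t b with h | h
    · simp only [k, if_pos h]
      rw [hsqrt t ⟨ht, h⟩, div_self (hF' t ht).ne']
    · simp only [k, if_neg h.not_ge]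
  have hkpos : ∀ t, 0 < k t := fun t => by
    rcases le_or_gt t b with h | h
    · simp [k, h]
    · have ht := (hab.trans h).le
      rw [hka t ht]
      exact div_pos (hF' t ht) (Real.sqrt_pos.2 (hrad t ht))
  have hk : ContDiff ℝ (⊤ : ℕ∞) k := by
    rw [contDiff_iff_contDiffAt]
    intro t
    rcases lt_or_ge t b with h | h
    · refine (contDiffAt_const (c := (1 : ℝ))).congr_of_eventuallyEq ?_
      filter_upwards [Iio_mem_nhds h] with y hy using if_pos (le_of_lt hy)
    · have ht : a < t := hab.trans_le h
      have : ContDiffAt ℝ (⊤ : ℕ∞) (fun t => deriv F t / √(1 - 2 * M t / F t)) t := by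
        refine hFc.contDiffAt.div (ContDiffAt.sqrt ?_ (hrad t ht.le).ne')
          (Real.sqrt_pos.2 (hrad t ht.le)).ne'
        exact contDiffAt_const.sub
          ((contDiffAt_const.mul hM.contDiffAt).div hF.contDiffAt (hFpos t ht.le).ne')
      refine this.congr_of_eventuallyEq ?_
      filter_upwards [Ioi_mem_nhds ht] with y hy using hka y (le_of_lt hy)
  let K : ℝ → ℝ := fun t => b + ∫ x in b..t, k x
  have hKd : ∀ t, HasDerivAt K (k t) t := fun t =>
    (hk.continuous.integral_hasStrictDerivAt b t).hasDerivAt.const_add b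
  have hK : ContDiff ℝ (⊤ : ℕ∞) K := by
    refine contDiff_infty_iff_deriv.2 ⟨fun t => (hKd t).differentiableAt, ?_⟩
    rwa [show deriv K = k from funext fun t => (hKd t).deriv]
  have hKb : ∀ t ≤ b, K t = t := fun t ht => by
    have : ∫ x in b..t, k x = ∫ _ in b..t, (1 : ℝ) := by
      refine intervalIntegral.integral_congr fun x hx => if_pos ?_
      rw [uIcc_of_ge ht] at hx
      exact hx.2
    simp only [K]
    rw [this]; simp
  have hKF : MonotoneOn (fun t => K t - F t) (Ici b) := by
    refine monotoneOn_of_deriv_nonneg (convex_Ici b) (hK.sub hF).continuous.continuousOn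
      ((hK.sub hF).differentiable (by simp)).differentiableOn fun t ht => ?_
    have ht' : b ≤ t := interior_subset ht
    have hta := hab.le.trans ht'
    rw [((hKd t).fun_sub (hFd t).hasDerivAt).deriv, hka t hta, sub_nonneg]
    refine le_div_self (hF' t hta).le (Real.sqrt_pos.2 (hrad t hta)) (Real.sqrt_le_one.2 ?_)
    have : 0 ≤ 2 * M t / F t := div_nonneg (by linarith [hM0 t ht']) (hFpos t hta).le
    linarith
  have hKlim : Filter.Tendsto K Filter.atTop Filter.atTop := by
    refine Filter.tendsto_atTop_mono' _ ?_
      (Filter.tendsto_atTop_add_const_right Filter.atTop (K b - F b) hFlim)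
    filter_upwards [Filter.eventually_ge_atTop b] with t ht
    have : K b - F b ≤ K t - F t := hKF self_mem_Ici ht ht
    linarith
  obtain ⟨θ, hθ, hθm, hθK, hθd⟩ := exists_smooth_inverse hK hKd hkpos hKb hKlim
  have hθb : ∀ t ≤ b, θ t = t := fun t ht => by
    have := hθK t
    rwa [hKb t ht] at this
  refine ⟨θ, hθ, hθm, hθb, hθm.monotone.tendsto_atTop_atTop fun t => ⟨K t, (hθK t).ge⟩,
    fun s hs => ?_⟩
  have hθs : a ≤ θ s := by
    rw [← hθb a hab.le]; exact hθm.monotone hs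
  rw [((hFd (θ s)).hasDerivAt.comp s (hθd s)).deriv, hka _ hθs]
  have h1 := (hF' _ hθs).ne'
  field_simp

/-- The gluing statement for a profile that is smooth on the whole line. -/
theorem exists_schwarzschild_continuation {a b : ℝ} (hab : a < b) {F₀ : ℝ → ℝ}
    (hF₀ : ContDiff ℝ (⊤ : ℕ∞) F₀) (hF₀a : 0 < F₀ a) (hF₀' : ∀ t ∈ Icc a b, 0 < deriv F₀ t)
    (hscal : ∀ t ∈ Icc a b, 0 < 1 - deriv F₀ t ^ 2 - 2 * F₀ t * deriv (deriv F₀) t)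
    (hmass : 0 ≤ hawkingMass F₀ b) {m : ℝ} (hm : hawkingMass F₀ b < m) :
    ∃ c, b < c ∧ ∃ g : ℝ → ℝ, ContDiff ℝ (⊤ : ℕ∞) g ∧ EqOn g F₀ (Iic b) ∧
      (∀ s, a ≤ s → 0 < g s ∧ 0 < deriv g s) ∧
      (∀ s, a ≤ s → 0 ≤ 1 - deriv g s ^ 2 - 2 * g s * deriv (deriv g) s) ∧
      ∀ s, c ≤ s → 2 * m < g s ∧ deriv g s = √(1 - 2 * m / g s) := by
  obtain ⟨F, hF, hFF₀, hF', hFlim⟩ := exists_increasing_continuation hab hF₀ hF₀'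
  have hFmono : MonotoneOn F (Ici a) :=
    (strictMonoOn_of_deriv_pos (convex_Ici a) hF.continuous.continuousOn fun t ht =>
      hF' t (interior_subset ht)).monotoneOn
  have hFa : 0 < F a := by rwa [hFF₀ hab.le]
  have hFpos : ∀ t, a ≤ t → 0 < F t := fun t ht => hFa.trans_le (hFmono self_mem_Ici ht ht)
  have hd1 : EqOn (deriv F) (deriv F₀) (Iic b) := fun t ht => by
    rw [← (hF.differentiable (by simp) t).derivWithin (uniqueDiffOn_Iic b t ht),
      ← (hF₀.differentiable (by simp) t).derivWithin (uniqueDiffOn_Iic b t ht)]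
    exact derivWithin_congr hFF₀ (hFF₀ ht)
  have hd2 : EqOn (deriv (deriv F)) (deriv (deriv F₀)) (Iic b) := fun t ht => by
    rw [← hF.derivWithin_derivWithin_eq (uniqueDiffOn_Iic b) ht,
      ← hF₀.derivWithin_derivWithin_eq (uniqueDiffOn_Iic b) ht]
    have h : EqOn (derivWithin F (Iic b)) (derivWithin F₀ (Iic b)) (Iic b) :=
      fun y hy => derivWithin_congr hFF₀ (hFF₀ hy)
    exact derivWithin_congr h (h ht)
  have hb : hawkingMass F b = hawkingMass F₀ b := by
    rw [hawkingMass, hawkingMass, hFF₀ self_mem_Iic, hd1 self_mem_Iic]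
  obtain ⟨M, hM, hMb, hMmono, hMF, T, hT, hMT⟩ :=
    exists_mass_continuation hab hFmono hFlim (contDiff_hawkingMass hF) (m := m)
      (fun t ht => by
        rw [(hasDerivAt_hawkingMass hF t).deriv, hFF₀ ht.2, hd1 ht.2, hd2 ht.2]
        exact mul_pos (half_pos (hF₀' t ht)) (hscal t ht))
      (fun t ht => by
        have := mul_pos (hFpos t ht) (pow_pos (hF' t ht) 2)
        simp only [hawkingMass]; linarith)
      (hb ▸ hm)
  have hM0 : ∀ t, b ≤ t → 0 ≤ M t := fun t ht => by
    have h1 : M b ≤ M t := hMmono hab.le (hab.le.trans ht) ht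
    rw [hMb self_mem_Iic, hb] at h1
    exact hmass.trans h1
  obtain ⟨θ, hθ, hθm, hθb, hθlim, hθd⟩ :=
    exists_profile_of_mass hab hF hFa hF' hFlim hM hMb hMF hM0
  have hθa : ∀ s, a ≤ s → a ≤ θ s := fun s hs => by
    rw [← hθb a hab.le]; exact hθm.monotone hs
  have hrad : ∀ t, a ≤ t → 0 < 1 - 2 * M t / F t := fun t ht => by
    rw [sub_pos, div_lt_one (hFpos t ht)]; exact hMF t ht
  have hg : ContDiff ℝ (⊤ : ℕ∞) (F ∘ θ) := hF.comp hθ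
  have hg' : ∀ s, a ≤ s → 0 < deriv (F ∘ θ) s := fun s hs => by
    rw [hθd s hs]; exact Real.sqrt_pos.2 (hrad _ (hθa s hs))
  have hgmass : EqOn (hawkingMass (F ∘ θ)) (M ∘ θ) (Ici a) := fun s hs => by
    have h1 := (hFpos _ (hθa s hs)).ne'
    rw [hawkingMass, hθd s hs, Real.sq_sqrt (hrad _ (hθa s hs)).le]
    simp only [Function.comp_apply]
    field_simp
    ring
  have hgmono : MonotoneOn (hawkingMass (F ∘ θ)) (Ici a) := fun x hx y hy hxy => by
    rw [hgmass hx, hgmass hy]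
    exact hMmono (hθa x hx) (hθa y hy) (hθm.monotone hxy)
  obtain ⟨c, hc⟩ := Filter.eventually_atTop.1 (hθlim.eventually_ge_atTop T)
  refine ⟨max c (b + 1), lt_max_of_lt_right (lt_add_one b), F ∘ θ, hg, ?_, ?_, ?_, ?_⟩
  · intro s hs
    rw [Function.comp_apply, hθb s hs, hFF₀ hs]
  · exact fun s hs => ⟨hFpos _ (hθa s hs), hg' s hs⟩
  · intro s hs
    have h1 : 0 ≤ derivWithin (hawkingMass (F ∘ θ)) (Ici a) s := hgmono.derivWithin_nonneg
    rw [(hasDerivAt_hawkingMass hg s).hasDerivWithinAt.derivWithin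
      (uniqueDiffOn_Ici a s hs)] at h1
    exact nonneg_of_mul_nonneg_right h1 (half_pos (hg' s hs))
  · intro s hs
    have hsT : T ≤ θ s := hc s ((le_max_left _ _).trans hs)
    have hsa : a ≤ s := by linarith [(le_max_right c (b + 1)).trans hs]
    have h1 := hMF _ (hθa s hsa)
    have h2 := hθd s hsa
    rw [hMT _ hsT] at h1 h2
    exact ⟨h1, h2⟩

/-- CMC-gluing to a Schwarzschild manifold (radial profile form): a smooth increasing
positive profile with positive scalar curvature (`1 - f'^2 - 2 f f'' > 0`) and
non-negative Hawking mass at the outer boundary can be smoothly extended to `[a,∞)`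
with non-negative scalar curvature, positive mean curvature spheres, eventually
coinciding with the exterior Schwarzschild profile of any mass `m` exceeding the
boundary Hawking mass. -/
theorem cmc_gluing_to_Schwarzschild
    (a b : ℝ) (hab : a < b) (f : ℝ → ℝ)
    (hf : ContDiffOn ℝ (⊤ : ℕ∞) f (Icc a b))
    (hpos : ∀ s ∈ Icc a b, 0 < f s ∧ 0 < derivWithin f (Icc a b) s)
    (hscal : ∀ s ∈ Icc a b,
      0 < 1 - (derivWithin f (Icc a b) s) ^ 2
        - 2 * f s * derivWithin (derivWithin f (Icc a b)) (Icc a b) s)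
    (hHawking : 0 ≤ f b / 2 * (1 - (derivWithin f (Icc a b) b) ^ 2)) :
    ∀ m : ℝ, f b / 2 * (1 - (derivWithin f (Icc a b) b) ^ 2) < m →
    ∃ c : ℝ, b < c ∧ ∃ g : ℝ → ℝ, ContDiffOn ℝ (⊤ : ℕ∞) g (Ici a) ∧
      (∀ s ∈ Icc a b, g s = f s) ∧
      (∀ s ∈ Ici a, 0 < g s ∧ 0 < derivWithin g (Ici a) s) ∧
      (∀ s ∈ Ici a,
        0 ≤ 1 - (derivWithin g (Ici a) s) ^ 2
          - 2 * g s * derivWithin (derivWithin g (Ici a)) (Ici a) s) ∧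
      (∀ s : ℝ, c ≤ s → 2 * m < g s ∧
        derivWithin g (Ici a) s = Real.sqrt (1 - 2 * m / g s)) := by
  intro m hm
  obtain ⟨F, hF, hFf⟩ := exists_contDiff_eqOn_Icc hab hf
  have hu := uniqueDiffOn_Icc hab
  have hd1 : EqOn (derivWithin f (Icc a b)) (deriv F) (Icc a b) := fun s hs => by
    rw [← (hF.differentiable (by simp) s).derivWithin (hu s hs)]
    exact derivWithin_congr hFf.symm (hFf hs).symm
  have hd2 : ∀ s ∈ Icc a b,
      derivWithin (derivWithin f (Icc a b)) (Icc a b) s = deriv (deriv F) s := fun s hs => by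
    rw [← hF.derivWithin_derivWithin_eq hu hs]
    have h : EqOn (derivWithin f (Icc a b)) (derivWithin F (Icc a b)) (Icc a b) :=
      fun y hy => derivWithin_congr hFf.symm (hFf hy).symm
    exact derivWithin_congr h (h hs)
  have hb : b ∈ Icc a b := right_mem_Icc.2 hab.le
  have hmass : f b / 2 * (1 - derivWithin f (Icc a b) b ^ 2) = hawkingMass F b := by
    rw [hawkingMass, hFf hb, hd1 hb]
  rw [hmass] at hHawking hm
  obtain ⟨c, hc, g, hg, hgF, hgpos, hgscal, hgS⟩ := exists_schwarzschild_continuation hab hF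
    (by rw [hFf (left_mem_Icc.2 hab.le)]; exact (hpos a (left_mem_Icc.2 hab.le)).1)
    (fun s hs => by rw [← hd1 hs]; exact (hpos s hs).2)
    (fun s hs => by rw [← hd1 hs, ← hd2 s hs, hFf hs]; exact hscal s hs) hHawking hm
  have hv := uniqueDiffOn_Ici a
  have hgd : ∀ s ∈ Ici a, derivWithin g (Ici a) s = deriv g s := fun s hs =>
    (hg.differentiable (by simp) s).derivWithin (hv s hs)
  refine ⟨c, hc, g, hg.contDiffOn, fun s hs => (hgF hs.2).trans (hFf hs), fun s hs => ?_,
    fun s hs => ?_, fun s hs => ?_⟩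
  · rw [hgd s hs]; exact hgpos s hs
  · rw [hgd s hs, hg.derivWithin_derivWithin_eq hv hs]; exact hgscal s hs
  · rw [hgd s (hab.le.trans (hc.le.trans hs))]; exact hgS s hs
end

section
/- Let $m, Q \in \mathbb{R}$ with $m > |Q|$, and set $r_+ = m + \sqrt{m^2 - Q^2}$. There exists a function $u : [0,\infty) \to \mathbb{R}$, smooth on $[0,\infty)$ (with one-sided derivatives at $0$), such that: (a) $u(0) = r_+$; (b) $u(s) > r_+$ for all $s > 0$, and $u'(s) = \sqrt{1 - 2m/u(s) + Q^2/u(s)^2}$ for all $s \geq 0$ (in particular $u'(0) = 0$ and $u' > 0$ on $(0,\infty)$); (c) $u''(s) = m/u(s)^2 - Q^2/u(s)^3$ for all $s \geq 0$; and (d) $u(s) \to \infty$ as $s \to \infty$. -/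
open Set

theorem strictMono_mul_add_mul_sinh {m a : ℝ} (hm : 0 < m) (ha : 0 < a) :
    StrictMono fun x : ℝ => m * x + a * Real.sinh x := by
  intro x y hxy
  have := Real.sinh_strictMono hxy
  simp only
  gcongr

theorem hasDerivAt_mul_add_mul_sinh (m a x : ℝ) :
    HasDerivAt (fun x : ℝ => m * x + a * Real.sinh x) (m + a * Real.cosh x) x := by
  simpa using ((hasDerivAt_id' x).const_mul m).fun_add ((Real.hasDerivAt_sinh x).const_mul a)

theorem surjective_mul_add_mul_sinh {m a : ℝ} (hm : 0 < m) (ha : 0 < a) :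
    Function.Surjective fun x : ℝ => m * x + a * Real.sinh x := by
  refine Continuous.surjective (by fun_prop) ?_ ?_
  · refine Filter.tendsto_atTop_mono' _ ?_ (Filter.tendsto_id.const_mul_atTop hm)
    filter_upwards [Filter.eventually_ge_atTop 0] with x hx
    have := Real.sinh_nonneg_iff.2 hx
    simp only [id]
    nlinarith
  · refine Filter.tendsto_atBot_mono' _ ?_ (Filter.tendsto_id.const_mul_atBot hm)
    filter_upwards [Filter.eventually_le_atBot 0] with x hx
    have := Real.sinh_nonpos_iff.2 hx
    simp only [id]
    nlinarith

/-- The arclength `s = m x + a sinh x` from the horizon, as a function of the parameter `x`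
for which `r = m + a cosh x`. -/
noncomputable def arclengthIso {m a : ℝ} (hm : 0 < m) (ha : 0 < a) : ℝ ≃o ℝ :=
  (strictMono_mul_add_mul_sinh hm ha).orderIsoOfSurjective _ (surjective_mul_add_mul_sinh hm ha)

section arclengthIso

variable {m a : ℝ} (hm : 0 < m) (ha : 0 < a)

theorem arclengthIso_apply (x : ℝ) : arclengthIso hm ha x = m * x + a * Real.sinh x := rfl

theorem arclengthIso_symm_zero : (arclengthIso hm ha).symm 0 = 0 := by
  rw [OrderIso.symm_apply_eq, arclengthIso_apply]
  simp

theorem hasDerivAt_arclengthIso_symm (s : ℝ) :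
    HasDerivAt (arclengthIso hm ha).symm
      (m + a * Real.cosh ((arclengthIso hm ha).symm s))⁻¹ s := by
  have hpos : 0 < m + a * Real.cosh ((arclengthIso hm ha).symm s) := by
    have := Real.cosh_pos ((arclengthIso hm ha).symm s)
    positivity
  exact (hasDerivAt_mul_add_mul_sinh m a _).of_local_left_inverse
    (arclengthIso hm ha).symm.continuous.continuousAt hpos.ne'
    (Filter.Eventually.of_forall (arclengthIso hm ha).apply_symm_apply)

theorem contDiff_arclengthIso_symm : ContDiff ℝ (⊤ : ℕ∞) (arclengthIso hm ha).symm := by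
  refine (arclengthIso hm ha).toHomeomorph.contDiff_symm_deriv
    (f' := fun x => m + a * Real.cosh x) (fun x => ?_)
    (fun x => hasDerivAt_mul_add_mul_sinh m a x) ?_
  · have := Real.cosh_pos x
    positivity
  · change ContDiff ℝ _ fun x : ℝ => m * x + a * Real.sinh x
    fun_prop

end arclengthIso

/-- Radial profile of the sub-extremal spatial Reissner–Nordström manifold of mass `m`
and charge `Q` with `m > |Q|`, in arclength coordinates: with `r₊ = m + √(m² - Q²)`,
there is a smooth function on `[0,∞)` with `u(0) = r₊`, `u > r₊` on `(0,∞)`,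
satisfying `u' = √(1 - 2m/u + Q²/u²)` (so `u'(0) = 0` and `u' > 0` for `s > 0`),
`u'' = m/u² - Q²/u³`, and `u(s) → ∞` as `s → ∞`. -/
theorem reissnerNordstrom_radial_profile (m Q : ℝ) (hmQ : |Q| < m) :
    ∃ u : ℝ → ℝ, ContDiffOn ℝ (⊤ : ℕ∞) u (Ici 0) ∧
      u 0 = m + Real.sqrt (m ^ 2 - Q ^ 2) ∧
      (∀ s : ℝ, 0 < s → m + Real.sqrt (m ^ 2 - Q ^ 2) < u s) ∧
      (∀ s : ℝ, 0 ≤ s →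
        derivWithin u (Ici 0) s
          = Real.sqrt (1 - 2 * m / u s + Q ^ 2 / (u s) ^ 2)) ∧
      derivWithin u (Ici 0) 0 = 0 ∧
      (∀ s : ℝ, 0 < s → 0 < derivWithin u (Ici 0) s) ∧
      (∀ s : ℝ, 0 ≤ s →
        derivWithin (derivWithin u (Ici 0)) (Ici 0) s
          = m / (u s) ^ 2 - Q ^ 2 / (u s) ^ 3) ∧
      Filter.Tendsto u Filter.atTop Filter.atTop := by
  set a := Real.sqrt (m ^ 2 - Q ^ 2)
  have hm : 0 < m := (abs_nonneg Q).trans_lt hmQ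
  have hQ : 0 < m ^ 2 - Q ^ 2 := sub_pos.2 (sq_lt_sq.2 (by rwa [abs_of_pos hm]))
  have ha : 0 < a := Real.sqrt_pos.2 hQ
  have ha2 : a ^ 2 = m ^ 2 - Q ^ 2 := Real.sq_sqrt hQ.le
  set X : ℝ → ℝ := ⇑(arclengthIso hm ha).symm
  have hX0 : X 0 = 0 := arclengthIso_symm_zero hm ha
  have hXmono : StrictMono X := (arclengthIso hm ha).symm.strictMono
  have hXpos : ∀ s, 0 < s → 0 < X s := fun s hs => hX0 ▸ hXmono hs
  have hX' : ∀ s, HasDerivAt X (m + a * Real.cosh (X s))⁻¹ s :=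
    hasDerivAt_arclengthIso_symm hm ha
  have hr : ∀ s, 0 < m + a * Real.cosh (X s) := fun s => by
    have := Real.cosh_pos (X s)
    positivity
  have hu' : ∀ s, HasDerivAt (fun s => m + a * Real.cosh (X s))
      (a * Real.sinh (X s) / (m + a * Real.cosh (X s))) s := fun s => by
    refine (((hX' s).cosh.const_mul a).const_add m).congr_deriv ?_
    rw [div_eq_mul_inv, mul_assoc]
  have hdw : ∀ s ∈ Ici (0 : ℝ), derivWithin (fun s => m + a * Real.cosh (X s)) (Ici 0) s
      = a * Real.sinh (X s) / (m + a * Real.cosh (X s)) := fun s hs =>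
    (hu' s).hasDerivWithinAt.derivWithin (uniqueDiffOn_Ici 0 s hs)
  refine ⟨fun s => m + a * Real.cosh (X s), ?_, ?_, fun s hs => ?_, fun s hs => ?_, ?_,
    fun s hs => ?_, fun s hs => ?_, ?_⟩
  · exact (contDiff_const.add
      (contDiff_const.mul (contDiff_arclengthIso_symm hm ha).cosh)).contDiffOn
  · simp [hX0]
  · have := Real.one_lt_cosh.2 (hXpos s hs).ne'
    change m + a < m + a * Real.cosh (X s)
    nlinarith
  · rw [hdw s hs]
    have hX_nonneg : 0 ≤ X s := hX0 ▸ hXmono.monotone hs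
    have hsinh := Real.sinh_nonneg_iff.2 hX_nonneg
    rw [eq_comm, ← Real.sqrt_sq (div_nonneg (mul_nonneg ha.le hsinh) (hr s).le)]
    congr 1
    have hne := (hr s).ne'
    have hcs := Real.cosh_sq (X s)
    field_simp
    linear_combination ha2 + a ^ 2 * hcs
  · rw [hdw 0 self_mem_Ici]
    simp [hX0]
  · rw [hdw s hs.le]
    exact div_pos (mul_pos ha (Real.sinh_pos_iff.2 (hXpos s hs))) (hr s)
  · have hne := (hr s).ne'
    have h2 := ((hX' s).sinh.const_mul a).div (hu' s) hne
    rw [derivWithin_congr hdw (hdw s hs)]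
    refine (h2.hasDerivWithinAt.derivWithin (uniqueDiffOn_Ici 0 s hs)).trans ?_
    have hcs := Real.cosh_sq (X s)
    field_simp
    linear_combination ha2 + a ^ 2 * hcs
  · have hXtop : Filter.Tendsto X Filter.atTop Filter.atTop :=
      (arclengthIso hm ha).symm.tendsto_atTop
    refine Filter.tendsto_atTop_add_const_left _ _ (Filter.Tendsto.const_mul_atTop ha ?_)
    refine Filter.tendsto_atTop_mono' _ ?_ hXtop
    filter_upwards [hXtop.eventually_ge_atTop 0] with s hs
    exact (Real.self_le_sinh_iff.2 hs).trans (Real.sinh_lt_cosh _).le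
end

section
/- Let $f : [a,b] \to \mathbb{R}$ be a $C^2$ function with $f > 0$ and $f' \geq 0$ on $[a,b]$, and suppose $1 - f'(s)^2 - 2 f(s) f''(s) \geq 0$ for all $s \in [a,b]$. Then the function $s \mapsto \tfrac{f(s)}{2}(1 - f'(s)^2)$ is non-decreasing on $[a,b]$. If moreover $f' > 0$ and $1 - f'^2 - 2ff'' > 0$ on $[a,b]$, then this function is strictly increasing on $[a,b]$. -/
open Set

/-- Derivative of the Hawking mass of coordinate spheres along the radial profile. -/
theorem hasDerivWithinAt_hawkingMass {f g : ℝ → ℝ} {g' s : ℝ} {I : Set ℝ}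
    (hf : HasDerivWithinAt f (g s) I s) (hg : HasDerivWithinAt g g' I s) :
    HasDerivWithinAt (fun t => f t / 2 * (1 - g t ^ 2))
      (g s / 2 * (1 - g s ^ 2 - 2 * f s * g')) I s := by
  refine ((hf.div_const 2).mul ((hg.pow 2).const_sub 1)).congr_deriv ?_
  simp only [Pi.pow_apply]
  push_cast
  ring

/-- Monotonicity of the Hawking mass `s ↦ f(s)/2 · (1 - f'(s)²)` of coordinate spheres
along a rotationally symmetric manifold with non-negative scalar curvature
(`1 - f'^2 - 2 f f'' ≥ 0`) and non-negative mean curvature (`f' ≥ 0`); strict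
monotonicity under the strict hypotheses. -/
theorem hawking_mass_monotone (a b : ℝ) (hab : a < b) (f : ℝ → ℝ)
    (hf : ContDiffOn ℝ 2 f (Icc a b))
    (hpos : ∀ s ∈ Icc a b, 0 < f s)
    (hder : ∀ s ∈ Icc a b, 0 ≤ derivWithin f (Icc a b) s)
    (hscal : ∀ s ∈ Icc a b,
      0 ≤ 1 - (derivWithin f (Icc a b) s) ^ 2
        - 2 * f s * derivWithin (derivWithin f (Icc a b)) (Icc a b) s) :
    MonotoneOn (fun s => f s / 2 * (1 - (derivWithin f (Icc a b) s) ^ 2)) (Icc a b) ∧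
    ((∀ s ∈ Icc a b, 0 < derivWithin f (Icc a b) s) →
      (∀ s ∈ Icc a b,
        0 < 1 - (derivWithin f (Icc a b) s) ^ 2
          - 2 * f s * derivWithin (derivWithin f (Icc a b)) (Icc a b) s) →
      StrictMonoOn (fun s => f s / 2 * (1 - (derivWithin f (Icc a b) s) ^ 2))
        (Icc a b)) := by
  have hu : UniqueDiffOn ℝ (Icc a b) := uniqueDiffOn_Icc hab
  have hf' : DifferentiableOn ℝ f (Icc a b) := hf.differentiableOn (by norm_num)
  have hf'' : DifferentiableOn ℝ (derivWithin f (Icc a b)) (Icc a b) :=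
    (hf.derivWithin hu (m := 1) (by norm_num)).differentiableOn (by norm_num)
  have hm := fun s (hs : s ∈ Icc a b) =>
    hasDerivWithinAt_hawkingMass (hf' s hs).hasDerivWithinAt (hf'' s hs).hasDerivWithinAt
  have hcont := HasDerivWithinAt.continuousOn hm
  have hint : ∀ s ∈ interior (Icc a b), s ∈ Icc a b := fun s hs => interior_subset hs
  refine ⟨monotoneOn_of_hasDerivWithinAt_nonneg (convex_Icc a b) hcont
      (fun s hs => (hm s (hint s hs)).mono interior_subset) fun s hs =>
        mul_nonneg (div_nonneg (hder s (hint s hs)) zero_le_two) (hscal s (hint s hs)),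
    fun hder' hscal' => strictMonoOn_of_hasDerivWithinAt_pos (convex_Icc a b) hcont
      (fun s hs => (hm s (hint s hs)).mono interior_subset) fun s hs =>
        mul_pos (div_pos (hder' s (hint s hs)) zero_lt_two) (hscal' s (hint s hs))⟩
end

section
/- Let $f : [a,b] \to \mathbb{R}$ be a $C^2$ function with $f > 0$ and $f' \geq 0$ on $[a,b]$, and suppose $1 - f'(s)^2 - 2 f(s) f''(s) \geq -3 f(s)^2$ for all $s \in [a,b]$. Then the function $s \mapsto \tfrac{f(s)}{2}(1 - f'(s)^2 + f(s)^2)$ is non-decreasing on $[a,b]$. If moreover $f' > 0$ and $1 - f'^2 - 2ff'' > -3f^2$ on $[a,b]$, then this function is strictly increasing on $[a,b]$. -/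
open Set

/-- The first variation of the hyperbolic Hawking mass of coordinate spheres. -/
theorem hasDerivWithinAt_hyperbolicHawkingMass {f g : ℝ → ℝ} {g' x : ℝ} {s : Set ℝ}
    (hf : HasDerivWithinAt f (g x) s x) (hg : HasDerivWithinAt g g' s x) :
    HasDerivWithinAt (fun t => f t / 2 * (1 - (g t) ^ 2 + (f t) ^ 2))
      (g x / 2 * (1 - (g x) ^ 2 - 2 * f x * g' + 3 * (f x) ^ 2)) s x := by
  refine ((hf.div_const 2).mul (((hg.pow 2).const_sub 1).add (hf.pow 2))).congr_deriv ?_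
  simp only [Pi.add_apply, Pi.pow_apply]
  push_cast
  ring

/-- Monotonicity of the hyperbolic Hawking mass
`s ↦ f(s)/2 · (1 - f'(s)² + f(s)²)` of coordinate spheres along a rotationally
symmetric manifold with scalar curvature at least `-6`
(`1 - f'^2 - 2 f f'' ≥ -3 f²`) and non-negative mean curvature (`f' ≥ 0`); strict
monotonicity under the strict hypotheses. -/
theorem hyperbolic_hawking_mass_monotone (a b : ℝ) (hab : a < b) (f : ℝ → ℝ)
    (hf : ContDiffOn ℝ 2 f (Icc a b))
    (hpos : ∀ s ∈ Icc a b, 0 < f s)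
    (hder : ∀ s ∈ Icc a b, 0 ≤ derivWithin f (Icc a b) s)
    (hscal : ∀ s ∈ Icc a b,
      -3 * (f s) ^ 2 ≤ 1 - (derivWithin f (Icc a b) s) ^ 2
        - 2 * f s * derivWithin (derivWithin f (Icc a b)) (Icc a b) s) :
    MonotoneOn
      (fun s => f s / 2 * (1 - (derivWithin f (Icc a b) s) ^ 2 + (f s) ^ 2))
      (Icc a b) ∧
    ((∀ s ∈ Icc a b, 0 < derivWithin f (Icc a b) s) →
      (∀ s ∈ Icc a b,
        -3 * (f s) ^ 2 < 1 - (derivWithin f (Icc a b) s) ^ 2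
          - 2 * f s * derivWithin (derivWithin f (Icc a b)) (Icc a b) s) →
      StrictMonoOn
        (fun s => f s / 2 * (1 - (derivWithin f (Icc a b) s) ^ 2 + (f s) ^ 2))
        (Icc a b)) := by
  have hu : UniqueDiffOn ℝ (Icc a b) := uniqueDiffOn_Icc hab
  have hf' : DifferentiableOn ℝ (derivWithin f (Icc a b)) (Icc a b) :=
    (hf.derivWithin hu (m := 1) (by norm_num)).differentiableOn (by norm_num)
  have hm := fun s (hs : s ∈ Icc a b) => hasDerivWithinAt_hyperbolicHawkingMass
    (hf.differentiableOn (by norm_num) s hs).hasDerivWithinAt (hf' s hs).hasDerivWithinAt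
  have hc := fun s hs => (hm s hs).continuousWithinAt
  have hi : interior (Icc a b) ⊆ Icc a b := interior_subset
  refine ⟨monotoneOn_of_hasDerivWithinAt_nonneg (convex_Icc a b) hc
    (fun s hs => (hm s (hi hs)).mono hi) fun s hs => ?_, fun hder' hscal' =>
    strictMonoOn_of_hasDerivWithinAt_pos (convex_Icc a b) hc
      (fun s hs => (hm s (hi hs)).mono hi) fun s hs => ?_⟩
  · exact mul_nonneg (by linarith [hder s (hi hs)]) (by linarith [hscal s (hi hs)])
  · exact mul_pos (by linarith [hder' s (hi hs)]) (by linarith [hscal' s (hi hs)])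
end

section
/- Let $Q \in \mathbb{R}$ and let $f : [a,b] \to \mathbb{R}$ be a $C^2$ function with $f > 0$ and $f' \geq 0$ on $[a,b]$, and suppose $1 - f'(s)^2 - 2 f(s) f''(s) \geq Q^2/f(s)^2$ for all $s \in [a,b]$. Then the function $s \mapsto \tfrac{f(s)}{2}\big(1 + Q^2/f(s)^2 - f'(s)^2\big)$ is non-decreasing on $[a,b]$. If moreover $f' > 0$ and $1 - f'^2 - 2ff'' > Q^2/f^2$ on $[a,b]$, then this function is strictly increasing on $[a,b]$. -/
open Set

/-- Derivative of the charged Hawking mass along a radial profile with derivative `g`. -/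
theorem HasDerivWithinAt.chargedHawkingMass {f g : ℝ → ℝ} {S : Set ℝ} {s g' : ℝ} (Q : ℝ)
    (hf : HasDerivWithinAt f (g s) S s) (hg : HasDerivWithinAt g g' S s) (hs : f s ≠ 0) :
    HasDerivWithinAt (fun t => f t / 2 * (1 + Q ^ 2 / (f t) ^ 2 - (g t) ^ 2))
      (g s / 2 * (1 - (g s) ^ 2 - 2 * f s * g' - Q ^ 2 / (f s) ^ 2)) S s := by
  have h := (hf.div_const 2).fun_mul
    ((((hasDerivWithinAt_const s S (Q ^ 2)).fun_div (hf.fun_pow 2)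
      (pow_ne_zero 2 hs)).const_add 1).fun_sub (hg.fun_pow 2))
  refine h.congr_deriv ?_
  push_cast
  field_simp
  ring

/-- Monotonicity of the charged Hawking mass
`s ↦ f(s)/2 · (1 + Q²/f(s)² - f'(s)²)` of coordinate spheres along a rotationally
symmetric charged manifold satisfying the charged dominant energy condition
(`1 - f'^2 - 2 f f'' ≥ Q²/f²`) and non-negative mean curvature (`f' ≥ 0`); strict
monotonicity under the strict hypotheses. -/
theorem charged_hawking_mass_monotone (Q : ℝ) (a b : ℝ) (hab : a < b) (f : ℝ → ℝ)
    (hf : ContDiffOn ℝ 2 f (Icc a b))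
    (hpos : ∀ s ∈ Icc a b, 0 < f s)
    (hder : ∀ s ∈ Icc a b, 0 ≤ derivWithin f (Icc a b) s)
    (hscal : ∀ s ∈ Icc a b,
      Q ^ 2 / (f s) ^ 2 ≤ 1 - (derivWithin f (Icc a b) s) ^ 2
        - 2 * f s * derivWithin (derivWithin f (Icc a b)) (Icc a b) s) :
    MonotoneOn
      (fun s => f s / 2 * (1 + Q ^ 2 / (f s) ^ 2 - (derivWithin f (Icc a b) s) ^ 2))
      (Icc a b) ∧
    ((∀ s ∈ Icc a b, 0 < derivWithin f (Icc a b) s) →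
      (∀ s ∈ Icc a b,
        Q ^ 2 / (f s) ^ 2 < 1 - (derivWithin f (Icc a b) s) ^ 2
          - 2 * f s * derivWithin (derivWithin f (Icc a b)) (Icc a b) s) →
      StrictMonoOn
        (fun s =>
          f s / 2 * (1 + Q ^ 2 / (f s) ^ 2 - (derivWithin f (Icc a b) s) ^ 2))
        (Icc a b)) := by
  have hf' : ContDiffOn ℝ 1 (derivWithin f (Icc a b)) (Icc a b) :=
    hf.derivWithin (uniqueDiffOn_Icc hab) (by norm_num)
  have hmass := fun s (hs : s ∈ Icc a b) =>
    HasDerivWithinAt.chargedHawkingMass Q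
      (hf.differentiableOn (by norm_num) s hs).hasDerivWithinAt
      (hf'.differentiableOn (by norm_num) s hs).hasDerivWithinAt (hpos s hs).ne'
  have hcont := fun s hs => (hmass s hs).continuousWithinAt
  constructor
  · refine monotoneOn_of_hasDerivWithinAt_nonneg (convex_Icc a b) hcont
      (fun s hs => (hmass s (interior_subset hs)).mono interior_subset) fun s hs => ?_
    have hs' := interior_subset hs
    exact mul_nonneg (div_nonneg (hder s hs') zero_le_two) (sub_nonneg.2 (hscal s hs'))
  · intro hder' hscal'
    refine strictMonoOn_of_hasDerivWithinAt_pos (convex_Icc a b) hcont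
      (fun s hs => (hmass s (interior_subset hs)).mono interior_subset) fun s hs => ?_
    have hs' := interior_subset hs
    exact mul_pos (half_pos (hder' s hs')) (sub_pos.2 (hscal' s hs'))
end
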